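/- arXiv:1511.06337 — 3 statements merged into one kernel-verified Lean document; each statement's English description precedes it below -/
import Mathlib

section
/- Fix n ≥ 1 and let B be a connected-ribbon basis of degree n over ℚ. Let λ be a shape of size n that is not a connected ribbon (λ may be a disconnected ribbon, or may contain a 2×2 block of boxes). Writing the skew Schur function of λ as s_λ = Σ_{b∈B} c_b s_b with c_b ∈ ℚ, one has Σ_{b∈B} (−1)^{rows(b)} c_b = 0, where rows(b) denotes the number of nonempty rows of the ribbon b. -/
open scoped Classical

noncomputable section

/-- A box in the plane: `(row, column)`; rows increase downward, columns rightward. -/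
abbrev Box : Type := ℤ × ℤ

/-- Translate a finite set of boxes by the vector `t`. -/
def translateS (t : Box) (S : Finset Box) : Finset Box :=
  S.image (fun b => t + b)

/-- 180-degree rotation of a finite set of boxes. -/
def rot180 (S : Finset Box) : Finset Box :=
  S.image (fun b => ((-b.1, -b.2) : Box))

/-- The diagonal of a box: column index minus row index. -/
def diagB (b : Box) : ℤ := b.2 - b.1

/-- `S` is the Young diagram of a partition: a down-left closed set of boxes with
nonnegative coordinates, anchored at the origin region. -/
def IsYoungDiagram (S : Finset Box) : Prop :=
  ∀ b ∈ S, 0 ≤ b.1 ∧ 0 ≤ b.2 ∧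
    ∀ b' : Box, 0 ≤ b'.1 → 0 ≤ b'.2 → b'.1 ≤ b.1 → b'.2 ≤ b.2 → b' ∈ S

/-- `S` is a skew shape `λ / μ` (aligned at the top-left corner). -/
def IsSkewShape (S : Finset Box) : Prop :=
  ∃ mu lam : Finset Box, IsYoungDiagram mu ∧ IsYoungDiagram lam ∧ mu ⊆ lam ∧ S = lam \ mu

/-- A shape: a translate of a skew shape (possibly disconnected). -/
def IsShape (S : Finset Box) : Prop :=
  ∃ (t : Box) (T : Finset Box), IsSkewShape T ∧ S = translateS t T

/-- Two boxes are adjacent when they share an edge. -/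
def AdjB (x y : Box) : Prop :=
  (x.1 = y.1 ∧ (x.2 = y.2 + 1 ∨ y.2 = x.2 + 1)) ∨
  (x.2 = y.2 ∧ (x.1 = y.1 + 1 ∨ y.1 = x.1 + 1))

/-- A finite set of boxes is connected (and nonempty) via shared edges. -/
def IsConnectedShape (S : Finset Box) : Prop :=
  S.Nonempty ∧ ∀ x ∈ S, ∀ y ∈ S,
    Relation.ReflTransGen (fun a b => a ∈ S ∧ b ∈ S ∧ AdjB a b) x y

/-- `S` contains no 2×2 block of boxes. -/
def NoTwoByTwo (S : Finset Box) : Prop :=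
  ∀ r c : ℤ, ¬ (((r, c) : Box) ∈ S ∧ ((r, c + 1) : Box) ∈ S ∧
      ((r + 1, c) : Box) ∈ S ∧ ((r + 1, c + 1) : Box) ∈ S)

/-- A ribbon: a shape containing no 2×2 block of boxes. -/
def IsRibbon (S : Finset Box) : Prop := IsShape S ∧ NoTwoByTwo S

/-- Number of nonempty rows of a finite set of boxes. -/
def rowsOf (S : Finset Box) : ℕ := (S.image Prod.fst).card

/-- Number of nonempty columns of a finite set of boxes. -/
def colsOf (S : Finset Box) : ℕ := (S.image Prod.snd).card

/-- The concrete set of boxes `T` witnesses taking out on the left of `S`: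
there is a presentation `S = t + (λ \ μ)` and a partition `η` with `μ ⊆ η ⊆ λ`
such that `T = t + (η \ μ)`. -/
def TakenOutLeftAt (T S : Finset Box) : Prop :=
  ∃ (mu eta lam : Finset Box) (t : Box),
    IsYoungDiagram mu ∧ IsYoungDiagram eta ∧ IsYoungDiagram lam ∧
    mu ⊆ eta ∧ eta ⊆ lam ∧
    S = translateS t (lam \ mu) ∧ T = translateS t (eta \ mu)

/-- The concrete set of boxes `T` witnesses taking out on the right of `S`. -/
def TakenOutRightAt (T S : Finset Box) : Prop :=
  ∃ (mu eta lam : Finset Box) (t : Box),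
    IsYoungDiagram mu ∧ IsYoungDiagram eta ∧ IsYoungDiagram lam ∧
    mu ⊆ eta ∧ eta ⊆ lam ∧
    S = translateS t (lam \ mu) ∧ T = translateS t (lam \ eta)

/-- The shape `δ` (up to translation) can be taken out on the left of `S`. -/
def TakenOutLeft (δ S : Finset Box) : Prop :=
  ∃ T : Finset Box, (∃ u, T = translateS u δ) ∧ TakenOutLeftAt T S

/-- The shape `δ` (up to translation) can be taken out on the right of `S`. -/
def TakenOutRight (δ S : Finset Box) : Prop :=
  ∃ T : Finset Box, (∃ u, T = translateS u δ) ∧ TakenOutRightAt T S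

/-- The skew Schur polynomial of the set of boxes `S` in `m` variables: the sum over
semistandard fillings of `S` with entries in `{1, …, m}` (encoded as `Fin m`) of the
corresponding monomials.  Entries weakly increase left-to-right along rows and strictly
increase down columns. -/
def schurPoly (S : Finset Box) (m : ℕ) : MvPolynomial (Fin m) ℚ :=
  ∑ g ∈ Finset.univ.filter (fun g : (↥S → Fin m) =>
      (∀ b b' : ↥S, (b : Box).1 = (b' : Box).1 → (b : Box).2 ≤ (b' : Box).2 → g b ≤ g b') ∧
      (∀ b b' : ↥S, (b : Box).2 = (b' : Box).2 → (b : Box).1 < (b' : Box).1 → g b < g b')),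
    ∏ b : ↥S, MvPolynomial.X (g b)

/-- Two sets of boxes are Schur-equivalent when their skew Schur polynomials agree in
every number of variables. -/
def SchurEquiv (S T : Finset Box) : Prop := ∀ m : ℕ, schurPoly S m = schurPoly T m

/-- `b` is the northeasternmost box of `S`: minimal row, and maximal column in that row. -/
def IsNEBox (S : Finset Box) (b : Box) : Prop :=
  b ∈ S ∧ (∀ b' ∈ S, b.1 ≤ b'.1) ∧ (∀ b' ∈ S, b'.1 = b.1 → b'.2 ≤ b.2)

/-- `b` is the southwesternmost box of `S`: maximal row, and minimal column in that row. -/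
def IsSWBox (S : Finset Box) (b : Box) : Prop :=
  b ∈ S ∧ (∀ b' ∈ S, b'.1 ≤ b.1) ∧ (∀ b' ∈ S, b'.1 = b.1 → b.2 ≤ b'.2)

/-- `Wc` is a copy of `W` lying in the top of `α`: a connected subdiagram of `α`
containing the northeasternmost box of `α`. -/
def LiesInTopAt (W α Wc : Finset Box) : Prop :=
  (∃ t, Wc = translateS t W) ∧ Wc ⊆ α ∧ IsConnectedShape Wc ∧
  ∃ b, IsNEBox α b ∧ b ∈ Wc

/-- `Wc` is a copy of `W` lying in the bottom of `α`: a connected subdiagram of `α`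
containing the southwesternmost box of `α`. -/
def LiesInBottomAt (W α Wc : Finset Box) : Prop :=
  (∃ t, Wc = translateS t W) ∧ Wc ⊆ α ∧ IsConnectedShape Wc ∧
  ∃ b, IsSWBox α b ∧ b ∈ Wc

/-- The set of diagonals occupied by `S`. -/
def DiagSet (S : Finset Box) : Finset ℤ := S.image diagB

/-- `γ` is a `W → O → W` shape (when `right = true`) or a `W ↑ O ↑ W` shape (when
`right = false`), with lower copy `Wlow` and upper copy `Wup` of `W`, where
`translateS v Wlow = Wup`.  The conditions are those of McNamara–van Willigenburg:
`W` lies in the bottom and the top of `γ`; removing either copy of `W` leaves a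
connected shape; removing both copies leaves `O`; at least one diagonal lies strictly
between the two copies of `W`; the copies of `W` attach to `O` horizontally
(`right = true`) or vertically (`right = false`); and `W` is maximal. -/
def IsWOW (right : Bool) (γ W O Wlow Wup : Finset Box) (v : Box) : Prop :=
  IsShape γ ∧ IsShape W ∧
  LiesInBottomAt W γ Wlow ∧ LiesInTopAt W γ Wup ∧
  translateS v Wlow = Wup ∧
  IsShape (γ \ Wup) ∧ IsConnectedShape (γ \ Wup) ∧
  IsShape (γ \ Wlow) ∧ IsConnectedShape (γ \ Wlow) ∧
  O = γ \ (Wlow ∪ Wup) ∧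
  (∃ k : ℤ, (∀ b ∈ Wlow, diagB b < k) ∧ (∀ b ∈ Wup, k < diagB b)) ∧
  (if right then
      (∃ b, IsSWBox O b ∧ ((b.1, b.2 - 1) : Box) ∈ Wlow) ∧
      (∃ b, IsNEBox O b ∧ ((b.1, b.2 + 1) : Box) ∈ Wup)
    else
      (∃ b, IsSWBox O b ∧ ((b.1 + 1, b.2) : Box) ∈ Wlow) ∧
      (∃ b, IsNEBox O b ∧ ((b.1 - 1, b.2) : Box) ∈ Wup)) ∧
  (∀ W' Wlow' Wup' : Finset Box,
      LiesInBottomAt W' γ Wlow' → LiesInTopAt W' γ Wup' →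
      IsConnectedShape (γ \ Wup') → IsConnectedShape (γ \ Wlow') →
      Wlow ⊆ Wlow' → DiagSet Wlow' = DiagSet Wlow → Wlow' = Wlow)

/-- The upper-left boundary ribbon of `A`: boxes with no box of `A` diagonally
to the northwest. -/
def ulBoundary (A : Finset Box) : Finset Box :=
  A.filter (fun b => ((b.1 - 1, b.2 - 1) : Box) ∉ A)

/-- The bottom-right boundary ribbon of `A`: boxes with no box of `A` diagonally
to the southeast. -/
def brBoundary (A : Finset Box) : Finset Box :=
  A.filter (fun b => ((b.1 + 1, b.2 + 1) : Box) ∉ A)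

/-- The top key ribbon of a `WOW` shape `γ` (with `O = γ` minus the two copies of `W`
and with shift `v` from the lower to the upper copy of `W`), as a subset of the
amalgamation `γ ⨿_W γ = γ ∪ translateS v γ`, in the coordinates in which the lower
copy of `γ` is `γ` itself.  Positions along the upper-left boundary ribbon are
measured by diagonals. -/
def topKeyRibbon (right : Bool) (γ O : Finset Box) (v : Box) : Finset Box :=
  let A := γ ∪ translateS v γ
  let U := ulBoundary A
  if right then
    U.filter (fun b => (∀ b' ∈ U ∩ O, diagB b' < diagB b) ∧
      (∃ b' ∈ U ∩ translateS v O, diagB b ≤ diagB b'))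
  else
    U.filter (fun b => (∃ b' ∈ U ∩ O, diagB b' ≤ diagB b) ∧
      (∀ b' ∈ U ∩ translateS v O, diagB b < diagB b'))

/-- The bottom key ribbon of a `WOW` shape `γ`, along the bottom-right boundary
ribbon of `γ ⨿_W γ`. -/
def bottomKeyRibbon (right : Bool) (γ O : Finset Box) (v : Box) : Finset Box :=
  let A := γ ∪ translateS v γ
  let D := brBoundary A
  if right then
    D.filter (fun b => (∃ b' ∈ D ∩ O, diagB b' ≤ diagB b) ∧
      (∀ b' ∈ D ∩ translateS v O, diagB b < diagB b'))
  else
    D.filter (fun b => (∀ b' ∈ D ∩ O, diagB b' < diagB b) ∧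
      (∃ b' ∈ D ∩ translateS v O, diagB b ≤ diagB b'))

/-- The offset of the copy of `γ` corresponding to a box immediately to the east:
amalgamation for `W→O→W` shapes, shifted amalgamation for `W↑O↑W` shapes. -/
def eVec (right : Bool) (v : Box) : Box := if right then v else v + ((1, 1) : Box)

/-- The offset of the copy of `γ` corresponding to a box immediately to the north:
shifted amalgamation for `W→O→W` shapes, amalgamation for `W↑O↑W` shapes. -/
def nVec (right : Bool) (v : Box) : Box := if right then v + ((-1, -1) : Box) else v

/-- The offset of the copy of `γ` corresponding to the box `b = (r, c)` of `α` in the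
composition `α ∘_W γ`: each step east adds `eVec`, each step north adds `nVec`. -/
def boxOffset (right : Bool) (v : Box) (b : Box) : Box :=
  b.2 • eVec right v - b.1 • nVec right v

/-- The composition `α ∘_W γ`: one copy of `γ` per box of `α`, overlapped by
amalgamations and shifted amalgamations according to the type of `γ`. -/
def composeWOW (right : Bool) (γ : Finset Box) (v : Box) (α : Finset Box) : Finset Box :=
  α.biUnion (fun b => translateS (boxOffset right v b) γ)

/-- `γ` has no loose end ribbons (n being the size of its key ribbons): for a
`W→O→W` shape, no ribbon of size `n` beginning (strictly smaller diagonal) to the left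
of the top key ribbon can be taken out on the left of `γ`, and no ribbon of size `n`
ending (strictly larger diagonal) to the right of the bottom key ribbon can be taken out
on the right of `γ`; for a `W↑O↑W` shape, the corresponding conditions with the ends
swapped. -/
def NoLooseEndRibbons (right : Bool) (γ O : Finset Box) (v : Box) : Prop :=
  let n := (topKeyRibbon right γ O v).card
  if right then
    (∀ T : Finset Box, IsRibbon T → T.card = n → TakenOutLeftAt T γ →
        ¬ ∃ b ∈ T, ∀ b' ∈ topKeyRibbon right γ O v, diagB b < diagB b') ∧
    (∀ T : Finset Box, IsRibbon T → T.card = n → TakenOutRightAt T γ →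
        ¬ ∃ b ∈ T, ∀ b' ∈ bottomKeyRibbon right γ O v, diagB b' < diagB b)
  else
    (∀ T : Finset Box, IsRibbon T → T.card = n → TakenOutLeftAt T γ →
        ¬ ∃ b ∈ T, ∀ b' ∈ topKeyRibbon right γ O v, diagB b' < diagB b) ∧
    (∀ T : Finset Box, IsRibbon T → T.card = n → TakenOutRightAt T γ →
        ¬ ∃ b ∈ T, ∀ b' ∈ bottomKeyRibbon right γ O v, diagB b < diagB b')

/-- The `a × b` rectangle of boxes (rows `0, …, a-1`, columns `0, …, b-1`). -/
def rectShape (a b : ℕ) : Finset Box :=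
  (Finset.range a ×ˢ Finset.range b).image (fun p => (((p.1 : ℤ), (p.2 : ℤ)) : Box))

/-- The rectangle with its lower-right corner box removed. -/
def betaShape (a b : ℕ) : Finset Box :=
  rectShape a b \ {(((a : ℤ) - 1, (b : ℤ) - 1) : Box)}

/-- The truncation window `{-N, …, N} × {-N, …, N}`. -/
def truncBox (N : ℕ) : Set Box :=
  {b : Box | -(N : ℤ) ≤ b.1 ∧ b.1 ≤ (N : ℤ) ∧ -(N : ℤ) ≤ b.2 ∧ b.2 ≤ (N : ℤ)}

/-- 180-degree rotation of a possibly infinite set of boxes. -/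
def rot180Set (Λ : Set Box) : Set Box := (fun b : Box => ((-b.1, -b.2) : Box)) '' Λ

/-- The composition `α ∘_W γ` for a possibly infinite set of boxes `α`. -/
def composeWOWSet (right : Bool) (γ : Finset Box) (v : Box) (α : Set Box) : Set Box :=
  ⋃ b ∈ α, (↑(translateS (boxOffset right v b) γ) : Set Box)

/-- An embedded infinite shape: an infinite set of boxes all of whose truncations
are shapes. -/
def IsInfiniteShape (Λ : Set Box) : Prop :=
  Λ.Infinite ∧ ∀ N : ℕ, ∃ F : Finset Box, (↑F : Set Box) = Λ ∩ truncBox N ∧ IsShape F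

/-- The fixed placement `T` witnesses taking out on the left of the infinite set of
boxes `Λ`: it witnesses taking out on the left of every sufficiently large truncation. -/
def TakenOutLeftInfAt (T : Finset Box) (Λ : Set Box) : Prop :=
  ∃ N₀ : ℕ, ∀ N : ℕ, N₀ ≤ N → ∀ F : Finset Box,
    (↑F : Set Box) = Λ ∩ truncBox N → TakenOutLeftAt T F

/-- The fixed placement `T` witnesses taking out on the right of the infinite set of
boxes `Λ`. -/
def TakenOutRightInfAt (T : Finset Box) (Λ : Set Box) : Prop :=
  ∃ N₀ : ℕ, ∀ N : ℕ, N₀ ≤ N → ∀ F : Finset Box,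
    (↑F : Set Box) = Λ ∩ truncBox N → TakenOutRightAt T F

/-- The shape `δ` (up to translation) can be taken out on the left of the infinite set
of boxes `Λ`. -/
def TakenOutLeftInf (δ : Finset Box) (Λ : Set Box) : Prop :=
  ∃ T : Finset Box, (∃ u, T = translateS u δ) ∧ TakenOutLeftInfAt T Λ

/-- The shape `δ` (up to translation) can be taken out on the right of the infinite set
of boxes `Λ`. -/
def TakenOutRightInf (δ : Finset Box) (Λ : Set Box) : Prop :=
  ∃ T : Finset Box, (∃ u, T = translateS u δ) ∧ TakenOutRightInfAt T Λ

/-- The boxes of `I` with another box of `I` to the left in the same row. -/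
def hasLeft (I : Finset Box) : Finset Box :=
  I.filter (fun b => ∃ a ∈ I, a.1 = b.1 ∧ a.2 < b.2)

/-- The boxes of `I` with no box of `I` below in the same column. -/
def noBelow (I : Finset Box) : Finset Box :=
  I.filter (fun b => ∀ a ∈ I, a.2 = b.2 → ¬ b.1 < a.1)

/-- `J` can be the set of boxes carrying the largest entry of a semistandard filling of `I`. -/
def IsTopStrip (I J : Finset Box) : Prop :=
  J ⊆ I ∧ (∀ b ∈ J, ∀ b' ∈ I, b.1 = b'.1 → b.2 ≤ b'.2 → b' ∈ J) ∧
    (∀ b ∈ J, ∀ b' ∈ I, b.2 = b'.2 → ¬ b.1 < b'.1)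

/-- `V` has at most one box in each row. -/
def IsVerticalStrip (V : Finset Box) : Prop :=
  ∀ a ∈ V, ∀ b ∈ V, a.1 = b.1 → a = b

/-- The sign of a vertical strip, and zero for all other sets of boxes. -/
def verticalSign (V : Finset Box) : ℚ :=
  if IsVerticalStrip V then (-1) ^ V.card else 0

lemma isTopStrip_and_isVerticalStrip_iff (I J : Finset Box) :
    (IsTopStrip I J ∧ IsVerticalStrip (I \ J)) ↔ J ∈ Finset.Icc (hasLeft I) (noBelow I) := by
  rw [Finset.mem_Icc]
  constructor
  · rintro ⟨⟨hJ, hrow, hcol⟩, hV⟩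
    refine ⟨fun y hy => ?_, fun y hy => ?_⟩
    · obtain ⟨hyI, x, hx, hxy, hlt⟩ := Finset.mem_filter.1 hy
      by_contra hyJ
      have hxJ : x ∉ J := fun h => hyJ (hrow x h y hyI hxy hlt.le)
      have := hV x (Finset.mem_sdiff.2 ⟨hx, hxJ⟩) y (Finset.mem_sdiff.2 ⟨hyI, hyJ⟩) hxy
      rw [this] at hlt
      exact lt_irrefl _ hlt
    · exact Finset.mem_filter.2 ⟨hJ hy, fun a ha h => hcol y hy a ha h.symm⟩
  · rintro ⟨hN, hU⟩
    have hJ : J ⊆ I := hU.trans (Finset.filter_subset _ _)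
    refine ⟨⟨hJ, fun b hb b' hb' h1 h2 => ?_, fun b hb b' hb' h =>
      (Finset.mem_filter.1 (hU hb)).2 b' hb' h.symm⟩, fun a ha b hb h => ?_⟩
    · rcases h2.eq_or_lt with h2 | h2
      · rwa [← Prod.ext h1 h2]
      · exact hN (Finset.mem_filter.2 ⟨hb', b, hJ hb, h1, h2⟩)
    · rw [Finset.mem_sdiff] at ha hb
      rcases lt_trichotomy a.2 b.2 with h2 | h2 | h2
      · exact absurd (hN (Finset.mem_filter.2 ⟨hb.1, a, ha.1, h, h2⟩)) hb.2
      · exact Prod.ext h h2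
      · exact absurd (hN (Finset.mem_filter.2 ⟨ha.1, b, hb.1, h.symm, h2⟩)) ha.2

lemma sum_topStrip_mul_verticalSign (I : Finset Box) (F : Finset Box → ℚ) :
    ∑ J ∈ I.powerset.filter (IsTopStrip I), F J * verticalSign (I \ J) =
      ∑ J ∈ Finset.Icc (hasLeft I) (noBelow I), F J * (-1) ^ (I \ J).card := by
  have h : Finset.Icc (hasLeft I) (noBelow I) =
      (I.powerset.filter (IsTopStrip I)).filter (fun J => IsVerticalStrip (I \ J)) := by
    ext J
    rw [← isTopStrip_and_isVerticalStrip_iff, Finset.mem_filter, Finset.mem_filter,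
      Finset.mem_powerset]
    exact ⟨fun h => ⟨⟨h.1.1, h.1⟩, h.2⟩, fun h => ⟨h.1.2, h.2⟩⟩
  rw [h, Finset.sum_filter (fun J => IsVerticalStrip (I \ J))]
  refine Finset.sum_congr rfl fun J _ => ?_
  unfold verticalSign
  split_ifs <;> simp

lemma sum_Icc_alternating_eq_zero (I N U : Finset Box) (hU : U ⊆ I) (x : Box)
    (hxU : x ∈ U) (hxN : x ∉ N) (F : Finset Box → ℚ)
    (hF : ∀ J, x ∉ J → F (insert x J) = F J) :
    ∑ J ∈ Finset.Icc N U, F J * (-1) ^ (I \ J).card = 0 := by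
  have key : ∀ J, x ∉ J → F (insert x J) * (-1) ^ (I \ insert x J).card
      = - (F J * (-1) ^ (I \ J).card) := by
    intro J hx
    have h1 : (I \ J).card = (I \ insert x J).card + 1 := by
      rw [Finset.sdiff_insert, Finset.card_erase_add_one]
      exact Finset.mem_sdiff.2 ⟨hU hxU, hx⟩
    rw [h1, hF J hx, pow_succ]
    ring
  refine Finset.sum_involution (fun J _ => if x ∈ J then J.erase x else insert x J) ?_ ?_ ?_ ?_
  · intro J _
    by_cases hx : x ∈ J
    · have := key (J.erase x) (Finset.notMem_erase x J)
      rw [Finset.insert_erase hx] at this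
      rw [if_pos hx, this]
      ring
    · rw [if_neg hx, key J hx]
      ring
  · intro J _ _
    by_cases hx : x ∈ J
    · rw [if_pos hx]
      intro h
      rw [← h] at hx
      exact Finset.notMem_erase x J hx
    · rw [if_neg hx]
      intro h
      exact hx (h ▸ Finset.mem_insert_self x J)
  · intro J hJ
    rw [Finset.mem_Icc] at hJ ⊢
    by_cases hx : x ∈ J
    · rw [if_pos hx]
      exact ⟨fun y hy => Finset.mem_erase.2 ⟨fun h => hxN (h ▸ hy), hJ.1 hy⟩,
        (Finset.erase_subset _ _).trans hJ.2⟩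
    · rw [if_neg hx]
      exact ⟨hJ.1.trans (Finset.subset_insert _ _), Finset.insert_subset hxU hJ.2⟩
  · intro J _
    by_cases hx : x ∈ J
    · simp [hx]
    · simp [hx]

/-- A nonempty set of boxes has a lowest box, leftmost in its row. -/
lemma exists_lowest_leftmost {I : Finset Box} (hI : I.Nonempty) :
    ∃ x ∈ I, (∀ a ∈ I, a.1 ≤ x.1) ∧ (∀ a ∈ I, a.1 = x.1 → x.2 ≤ a.2) := by
  obtain ⟨y, hy, hmax⟩ := I.exists_max_image Prod.fst hI
  obtain ⟨x, hx, hmin⟩ := (I.filter (fun a => a.1 = y.1)).exists_min_image Prod.snd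
    ⟨y, Finset.mem_filter.2 ⟨hy, rfl⟩⟩
  rw [Finset.mem_filter] at hx
  refine ⟨x, hx.1, fun a ha => hx.2 ▸ hmax a ha, fun a ha h => hmin a ?_⟩
  exact Finset.mem_filter.2 ⟨ha, h.trans hx.2⟩

lemma mem_noBelow_sdiff_hasLeft {I : Finset Box} {x : Box} :
    x ∈ noBelow I \ hasLeft I ↔ x ∈ I ∧ (∀ a ∈ I, a.2 = x.2 → ¬ x.1 < a.1) ∧
      (∀ a ∈ I, a.1 = x.1 → ¬ a.2 < x.2) := by
  simp only [Finset.mem_sdiff, noBelow, hasLeft, Finset.mem_filter]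
  constructor
  · rintro ⟨⟨h1, h2⟩, h3⟩
    exact ⟨h1, h2, fun a ha h h' => h3 ⟨h1, a, ha, h, h'⟩⟩
  · rintro ⟨h1, h2, h3⟩
    exact ⟨⟨h1, h2⟩, fun ⟨_, a, ha, h, h'⟩ => h3 a ha h h'⟩

lemma sum_topStrip_verticalSign {I : Finset Box} (hI : I.Nonempty) :
    ∑ J ∈ I.powerset.filter (IsTopStrip I), verticalSign (I \ J) = 0 := by
  obtain ⟨x, hx, h1, h2⟩ := exists_lowest_leftmost hI
  have hx' : x ∈ noBelow I \ hasLeft I := mem_noBelow_sdiff_hasLeft.2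
    ⟨hx, fun a ha _ => (h1 a ha).not_gt, fun a ha h => (h2 a ha h).not_gt⟩
  rw [Finset.mem_sdiff] at hx'
  have := sum_topStrip_mul_verticalSign I (fun _ => 1)
  simp only [one_mul] at this
  rw [this]
  have h := sum_Icc_alternating_eq_zero I (hasLeft I) (noBelow I) (Finset.filter_subset _ _) x
    hx'.1 hx'.2 (fun _ => 1) (fun _ _ => rfl)
  simpa using h

/-- Semistandard fillings of `I ⊆ S` using exactly the entries `0, …, l - 1`, extended by the
value `l` to the remaining boxes of `S`. -/
def packedFillings (S I : Finset Box) (l : ℕ) : Finset (↥S → ℕ) :=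
  (Fintype.piFinset (fun _ : ↥S => Finset.range (l + 1))).filter (fun g =>
    (∀ b : ↥S, (b : Box) ∈ I ↔ g b < l) ∧ (∀ i < l, ∃ b, g b = i) ∧
    (∀ b b' : ↥S, (b : Box) ∈ I → (b' : Box) ∈ I →
      (b : Box).1 = (b' : Box).1 → (b : Box).2 ≤ (b' : Box).2 → g b ≤ g b') ∧
    (∀ b b' : ↥S, (b : Box) ∈ I → (b' : Box) ∈ I →
      (b : Box).2 = (b' : Box).2 → (b : Box).1 < (b' : Box).1 → g b < g b'))

lemma mem_packedFillings {S I : Finset Box} {l : ℕ} {g : ↥S → ℕ} :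
    g ∈ packedFillings S I l ↔ (∀ b, g b ≤ l) ∧
    (∀ b : ↥S, (b : Box) ∈ I ↔ g b < l) ∧ (∀ i < l, ∃ b, g b = i) ∧
    (∀ b b' : ↥S, (b : Box) ∈ I → (b' : Box) ∈ I →
      (b : Box).1 = (b' : Box).1 → (b : Box).2 ≤ (b' : Box).2 → g b ≤ g b') ∧
    (∀ b b' : ↥S, (b : Box) ∈ I → (b' : Box) ∈ I →
      (b : Box).2 = (b' : Box).2 → (b : Box).1 < (b' : Box).1 → g b < g b') := by
  simp [packedFillings]

/-- The set of boxes with entry `l`. -/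
def levelSet {S : Finset Box} (l : ℕ) (g : ↥S → ℕ) : Finset Box :=
  (Finset.univ.filter (fun b => g b = l)).image Subtype.val

lemma mem_levelSet {S : Finset Box} {l : ℕ} {g : ↥S → ℕ} (b : ↥S) :
    (b : Box) ∈ levelSet l g ↔ g b = l := by
  simp [levelSet]

lemma levelSet_eq_iff {S J : Finset Box} (hJ : J ⊆ S) {l : ℕ} {g : ↥S → ℕ} :
    levelSet l g = J ↔ ∀ b : ↥S, g b = l ↔ (b : Box) ∈ J := by
  constructor
  · rintro rfl b
    exact (mem_levelSet b).symm
  · intro h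
    ext x
    constructor
    · intro hx
      obtain ⟨b, hb, rfl⟩ := Finset.mem_image.1 hx
      exact (h b).1 (Finset.mem_filter.1 hb).2
    · intro hx
      exact (mem_levelSet ⟨x, hJ hx⟩).2 ((h ⟨x, hJ hx⟩).2 hx)

lemma levelSet_mem {S I : Finset Box} (hIS : I ⊆ S) {l : ℕ} {g : ↥S → ℕ}
    (hg : g ∈ packedFillings S I (l + 1)) :
    levelSet l g ∈ I.powerset.filter (fun J => IsTopStrip I J ∧ J.Nonempty) := by
  obtain ⟨hle, hI, hsurj, hrow, hcol⟩ := mem_packedFillings.1 hg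
  have hsub : levelSet l g ⊆ I := by
    intro x hx
    obtain ⟨b, hb, rfl⟩ := Finset.mem_image.1 hx
    exact (hI b).2 (by simp at hb; omega)
  rw [Finset.mem_filter, Finset.mem_powerset]
  refine ⟨hsub, ⟨hsub, fun b hb b' hb' h1 h2 => ?_, fun b hb b' hb' h1 h2 => ?_⟩, ?_⟩
  · obtain ⟨b, hbl, rfl⟩ := Finset.mem_image.1 hb
    have hbS : b' ∈ S := hIS hb'
    have h3 := hrow b ⟨b', hbS⟩ (hsub hb) hb' h1 h2
    have h4 := (hI ⟨b', hbS⟩).1 hb'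
    rw [(Finset.mem_filter.1 hbl).2] at h3
    exact (mem_levelSet ⟨b', hbS⟩).2 (by omega)
  · obtain ⟨b, hbl, rfl⟩ := Finset.mem_image.1 hb
    have hbS : b' ∈ S := hIS hb'
    have h3 := hcol b ⟨b', hbS⟩ (hsub hb) hb' h1 h2
    have h4 := (hI ⟨b', hbS⟩).1 hb'
    rw [(Finset.mem_filter.1 hbl).2] at h3
    omega
  · obtain ⟨b, hb⟩ := hsurj l (Nat.lt_succ_self l)
    exact ⟨b, (mem_levelSet b).2 hb⟩

lemma card_packedFillings_fiber {S I J : Finset Box} (hIS : I ⊆ S) (hJ : IsTopStrip I J)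
    (hne : J.Nonempty) (l : ℕ) :
    ((packedFillings S I (l + 1)).filter (fun g => levelSet l g = J)).card =
      (packedFillings S (I \ J) l).card := by
  obtain ⟨hJI, hJr, hJc⟩ := hJ
  refine Finset.card_bij' (fun g _ b => min (g b) l)
    (fun g _ b => if (b : Box) ∈ I then g b else l + 1) ?_ ?_ ?_ ?_
  · intro g hg
    rw [Finset.mem_filter, mem_packedFillings, levelSet_eq_iff (hJI.trans hIS)] at hg
    obtain ⟨⟨hle, hI, hsurj, hrow, hcol⟩, hlev⟩ := hg
    rw [mem_packedFillings]
    refine ⟨fun b => min_le_right _ _, fun b => ?_, fun i hi => ?_, ?_, ?_⟩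
    · rw [Finset.mem_sdiff, ← hlev, hI]
      omega
    · obtain ⟨b, hb⟩ := hsurj i (by omega)
      exact ⟨b, by omega⟩
    · intro b b' hb hb' h1 h2
      have := hrow b b' (Finset.mem_sdiff.1 hb).1 (Finset.mem_sdiff.1 hb').1 h1 h2
      omega
    · intro b b' hb hb' h1 h2
      have := hcol b b' (Finset.mem_sdiff.1 hb).1 (Finset.mem_sdiff.1 hb').1 h1 h2
      rw [Finset.mem_sdiff, ← hlev, hI] at hb'
      omega
  · intro g hg
    obtain ⟨hle, hI, hsurj, hrow, hcol⟩ := mem_packedFillings.1 hg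
    have hlev : ∀ b : ↥S, (b : Box) ∈ I → (g b = l ↔ (b : Box) ∈ J) := by
      intro b hb
      have h1 := hle b
      have h2 := hI b
      rw [Finset.mem_sdiff] at h2
      constructor
      · intro h
        by_contra hbJ
        have := h2.1 ⟨hb, hbJ⟩
        omega
      · intro h
        by_contra h'
        exact (h2.2 (by omega)).2 h
    rw [Finset.mem_filter, levelSet_eq_iff (hJI.trans hIS), mem_packedFillings]
    refine ⟨⟨fun b => ?_, fun b => ?_, fun i hi => ?_, ?_, ?_⟩, fun b => ?_⟩
    · have := hle b
      split_ifs <;> omega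
    · have := hle b
      split_ifs with h
      · simp only [h, true_iff]; omega
      · simp [h]
    · rcases Nat.lt_succ_iff_lt_or_eq.1 hi with hi | rfl
      · obtain ⟨b, hb⟩ := hsurj i hi
        refine ⟨b, ?_⟩
        rw [if_pos, hb]
        exact (Finset.mem_sdiff.1 ((hI b).2 (by omega))).1
      · obtain ⟨x, hx⟩ := hne
        refine ⟨⟨x, hIS (hJI hx)⟩, ?_⟩
        rw [if_pos (hJI hx)]
        exact (hlev _ (hJI hx)).2 hx
    · intro b b' hb hb' h1 h2
      rw [if_pos hb, if_pos hb']
      by_cases hbJ' : (b' : Box) ∈ J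
      · rw [(hlev b' hb').2 hbJ']
        exact hle b
      · have hbJ : (b : Box) ∉ J := fun h => hbJ' (hJr b h b' hb' h1 h2)
        exact hrow b b' (Finset.mem_sdiff.2 ⟨hb, hbJ⟩) (Finset.mem_sdiff.2 ⟨hb', hbJ'⟩) h1 h2
    · intro b b' hb hb' h1 h2
      rw [if_pos hb, if_pos hb']
      have hbJ : (b : Box) ∉ J := fun h => hJc b h b' hb' h1 h2
      by_cases hbJ' : (b' : Box) ∈ J
      · rw [(hlev b' hb').2 hbJ']
        exact (hI b).1 (Finset.mem_sdiff.2 ⟨hb, hbJ⟩)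
      · exact hcol b b' (Finset.mem_sdiff.2 ⟨hb, hbJ⟩) (Finset.mem_sdiff.2 ⟨hb', hbJ'⟩) h1 h2
    · split_ifs with h
      · exact hlev b h
      · exact ⟨fun h' => by omega, fun h' => absurd (hJI h') h⟩
  · intro g hg
    rw [Finset.mem_filter, mem_packedFillings] at hg
    obtain ⟨⟨hle, hI, -⟩, -⟩ := hg
    funext b
    have h1 := hle b
    have h2 := hI b
    dsimp only
    split_ifs with h
    · have := h2.1 h
      omega
    · rw [h2] at h
      omega
  · intro g hg
    obtain ⟨hle, hI, -⟩ := mem_packedFillings.1 hg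
    funext b
    have h1 := hle b
    have h2 := hI b
    dsimp only
    split_ifs with h
    · omega
    · rw [Finset.mem_sdiff] at h2
      have : ¬ g b < l := fun h' => h (h2.2 h').1
      omega

lemma sum_packedFillings_succ {S I : Finset Box} (hIS : I ⊆ S) (l : ℕ) (F : Finset Box → ℚ) :
    ∑ g ∈ packedFillings S I (l + 1), F (levelSet l g) =
      ∑ J ∈ I.powerset.filter (fun J => IsTopStrip I J ∧ J.Nonempty),
        F J * (packedFillings S (I \ J) l).card := by
  rw [← Finset.sum_fiberwise_of_maps_to (fun g hg => levelSet_mem hIS hg)]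
  refine Finset.sum_congr rfl fun J hJ => ?_
  obtain ⟨-, hJ, hne⟩ := Finset.mem_filter.1 hJ
  rw [← card_packedFillings_fiber hIS hJ hne l,
    Finset.sum_congr rfl (fun g hg => by rw [(Finset.mem_filter.1 hg).2]),
    Finset.sum_const, nsmul_eq_mul, mul_comm]

lemma filter_isTopStrip_eq_insert (I : Finset Box) :
    I.powerset.filter (IsTopStrip I) =
      insert ∅ (I.powerset.filter (fun J => IsTopStrip I J ∧ J.Nonempty)) := by
  ext J
  simp only [Finset.mem_insert, Finset.mem_filter, Finset.mem_powerset]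
  rcases J.eq_empty_or_nonempty with rfl | h
  · simp [IsTopStrip]
  · simp [h, h.ne_empty]

/-- The alternating sum over packed fillings is the sign of a vertical strip, or zero. -/
lemma sum_card_packedFillings (S : Finset Box) (k : ℕ) :
    ∀ I ⊆ S, I.card ≤ k →
      ∑ l ∈ Finset.range (k + 1), (-1 : ℚ) ^ l * (packedFillings S I l).card =
        verticalSign I := by
  induction k with
  | zero =>
    intro I _ hI
    obtain rfl : I = ∅ := Finset.card_eq_zero.1 (by omega)
    have : packedFillings S ∅ 0 = {fun _ => 0} := by
      ext g
      rw [mem_packedFillings, Finset.mem_singleton, funext_iff]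
      simp
    simp [this, verticalSign, IsVerticalStrip]
  | succ k ih =>
    intro I hIS hI
    rcases I.eq_empty_or_nonempty with rfl | hne
    · rw [Finset.sum_range_succ, ih ∅ hIS (by simp)]
      have : packedFillings S ∅ (k + 1) = ∅ := by
        refine Finset.eq_empty_of_forall_notMem fun g hg => ?_
        obtain ⟨-, h, hs, -⟩ := mem_packedFillings.1 hg
        obtain ⟨b, hb⟩ := hs 0 (by omega)
        exact absurd ((h b).2 (by omega)) (Finset.notMem_empty _)
      simp [this]
    · rw [Finset.sum_range_succ']
      have h0 : packedFillings S I 0 = ∅ := by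
        refine Finset.eq_empty_of_forall_notMem fun g hg => ?_
        obtain ⟨-, h, -⟩ := mem_packedFillings.1 hg
        obtain ⟨x, hx⟩ := hne
        exact absurd ((h ⟨x, hIS hx⟩).1 hx) (Nat.not_lt_zero _)
      have hrec : ∀ l, ((packedFillings S I (l + 1)).card : ℚ) =
          ∑ J ∈ I.powerset.filter (fun J => IsTopStrip I J ∧ J.Nonempty),
            ((packedFillings S (I \ J) l).card : ℚ) := by
        intro l
        have := sum_packedFillings_succ hIS l (fun _ => 1)
        simpa using this
      have hz := sum_topStrip_verticalSign hne
      rw [filter_isTopStrip_eq_insert, Finset.sum_insert (by simp), Finset.sdiff_empty] at hz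
      have hJ : ∀ J ∈ I.powerset.filter (fun J => IsTopStrip I J ∧ J.Nonempty),
          ∑ l ∈ Finset.range (k + 1), (-1 : ℚ) ^ l * (packedFillings S (I \ J) l).card =
            verticalSign (I \ J) := by
        intro J hJ
        rw [Finset.mem_filter, Finset.mem_powerset] at hJ
        refine ih _ (Finset.sdiff_subset.trans hIS) ?_
        have h1 := Finset.card_sdiff_add_card_eq_card hJ.1
        have h2 := hJ.2.2.card_pos
        omega
      rw [← Finset.sum_congr rfl hJ, Finset.sum_comm] at hz
      simp only [h0, hrec, Finset.card_empty, Nat.cast_zero, mul_zero, add_zero, pow_succ]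
      simp only [← Finset.mul_sum] at hz
      simp only [mul_neg, mul_one, neg_mul, Finset.sum_neg_distrib]
      linarith

/-- The weight of a monomial under `primitivePairing`. -/
def compositionWeight {m : ℕ} (a : Fin m →₀ ℕ) : ℚ :=
  ∑ l : Fin m, if (∀ i, i ≤ l ↔ a i ≠ 0) then (-1) ^ (l : ℕ) * (a l : ℚ) else 0

/-- The linear functional which on symmetric polynomials is the pairing with a power sum. -/
def primitivePairing (m : ℕ) : MvPolynomial (Fin m) ℚ →ₗ[ℚ] ℚ :=
  (MvPolynomial.basisMonomials (Fin m) ℚ).constr ℚ compositionWeight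

lemma primitivePairing_prod_X {m : ℕ} {ι : Type*} [Fintype ι] (g : ι → Fin m) :
    primitivePairing m (∏ b, MvPolynomial.X (g b)) =
      ∑ l : Fin m, if (∀ i, i ≤ l ↔ ∃ b, g b = i) then
        (-1) ^ (l : ℕ) * ((Finset.univ.filter (fun b => g b = l)).card : ℚ) else 0 := by
  have h : (∏ b, MvPolynomial.X (g b) : MvPolynomial (Fin m) ℚ) =
      MvPolynomial.basisMonomials (Fin m) ℚ (∑ b, Finsupp.single (g b) 1) := by
    simp only [MvPolynomial.coe_basisMonomials, MvPolynomial.monomial_sum_one]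
    rfl
  have hcoef : ∀ i, (∑ b, Finsupp.single (g b) 1 : Fin m →₀ ℕ) i =
      (Finset.univ.filter (fun b => g b = i)).card := by
    intro i
    rw [Finsupp.finsetSum_apply, Finset.card_filter]
    exact Finset.sum_congr rfl fun b _ => by rw [Finsupp.single_apply]
  rw [primitivePairing, h, Module.Basis.constr_basis, compositionWeight]
  refine Finset.sum_congr rfl fun l _ => ?_
  simp only [hcoef]
  refine if_congr (forall_congr' fun i => iff_congr Iff.rfl ?_) rfl rfl
  rw [Finset.card_ne_zero]
  simp [Finset.Nonempty]

lemma primitivePairing_schurPoly_eq_sum_packedFillings (S : Finset Box) (m : ℕ) :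
    primitivePairing m (schurPoly S m) = ∑ l ∈ Finset.range m, (-1 : ℚ) ^ l *
      ∑ g ∈ packedFillings S S (l + 1), ((levelSet l g).card : ℚ) := by
  rw [schurPoly, map_sum]
  simp only [primitivePairing_prod_X]
  rw [Finset.sum_comm, Finset.sum_range]
  refine Finset.sum_congr rfl fun l _ => ?_
  rw [← Finset.sum_filter, Finset.filter_filter, ← Finset.mul_sum]
  congr 1
  refine Finset.sum_bij' (fun g _ b => (g b : ℕ))
    (fun g hg b => ⟨g b, by
      have := ((mem_packedFillings.1 hg).2.1 b).1 b.2
      omega⟩) ?_ ?_ ?_ ?_ ?_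
  · intro g hg
    obtain ⟨-, ⟨hrow, hcol⟩, hlev⟩ := Finset.mem_filter.1 hg
    have hle : ∀ b, (g b : ℕ) ≤ l := fun b => (hlev (g b)).2 ⟨b, rfl⟩
    refine mem_packedFillings.2 ⟨fun b => (hle b).trans (Nat.le_succ _),
      fun b => iff_of_true b.2 (Nat.lt_succ_of_le (hle b)), fun i hi => ?_,
      fun b b' _ _ h1 h2 => hrow b b' h1 h2, fun b b' _ _ h1 h2 => hcol b b' h1 h2⟩
    obtain ⟨b, hb⟩ := (hlev ⟨i, by omega⟩).1 (Nat.le_of_lt_succ hi)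
    exact ⟨b, by rw [hb]⟩
  · intro g hg
    obtain ⟨-, hI, hsurj, hrow, hcol⟩ := mem_packedFillings.1 hg
    refine Finset.mem_filter.2 ⟨Finset.mem_univ _, ⟨fun b b' h1 h2 => hrow b b' b.2 b'.2 h1 h2,
      fun b b' h1 h2 => hcol b b' b.2 b'.2 h1 h2⟩, fun i => ⟨fun hi => ?_, ?_⟩⟩
    · obtain ⟨b, hb⟩ := hsurj i (Nat.lt_succ_of_le hi)
      exact ⟨b, Fin.ext hb⟩
    · rintro ⟨b, rfl⟩
      exact Nat.le_of_lt_succ ((hI b).1 b.2)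
  · intros; rfl
  · intros; rfl
  · intro g hg
    rw [levelSet, Finset.card_image_of_injective _ Subtype.val_injective]
    simp only [Fin.ext_iff]

lemma primitivePairing_schurPoly {S : Finset Box} {m : ℕ} (hS : S.Nonempty) (hm : S.card ≤ m) :
    primitivePairing m (schurPoly S m) =
      ∑ J ∈ Finset.Icc (hasLeft S) (noBelow S), (J.card : ℚ) * (-1) ^ (S \ J).card := by
  have hpos := hS.card_pos
  obtain ⟨k, rfl⟩ : ∃ k, m = k + 1 := ⟨m - 1, by omega⟩
  rw [primitivePairing_schurPoly_eq_sum_packedFillings, ← sum_topStrip_mul_verticalSign,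
    filter_isTopStrip_eq_insert, Finset.sum_insert (by simp)]
  simp only [sum_packedFillings_succ (Finset.Subset.refl S) _ (fun J => (J.card : ℚ)),
    Finset.mul_sum]
  rw [Finset.sum_comm]
  simp only [Finset.card_empty, Nat.cast_zero, zero_mul, zero_add]
  refine Finset.sum_congr rfl fun J hJ => ?_
  rw [Finset.mem_filter, Finset.mem_powerset] at hJ
  rw [← sum_card_packedFillings S k (S \ J) Finset.sdiff_subset, Finset.mul_sum]
  · exact Finset.sum_congr rfl fun l _ => by ring
  · have h1 := Finset.card_sdiff_add_card_eq_card hJ.1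
    have h2 := hJ.2.2.card_pos
    omega

lemma IsShape.mem_of_le_of_le {S : Finset Box} (hS : IsShape S) {x y z : Box} (hx : x ∈ S)
    (hz : z ∈ S) (hxy : x ≤ y) (hyz : y ≤ z) : y ∈ S := by
  obtain ⟨t, T, ⟨mu, lam, hmu, hlam, -, rfl⟩, rfl⟩ := hS
  rw [translateS, Finset.mem_image] at hx hz ⊢
  obtain ⟨x, hx, rfl⟩ := hx
  obtain ⟨z, hz, rfl⟩ := hz
  refine ⟨y - t, ?_, by abel⟩
  rw [Finset.mem_sdiff] at hx hz ⊢
  have hx0 := hlam x hx.1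
  simp only [Prod.le_def, Prod.fst_add, Prod.snd_add] at hxy hyz
  refine ⟨(hlam z hz.1).2.2 _ ?_ ?_ ?_ ?_, fun h => hx.2 ((hmu _ h).2.2 x hx0.1 hx0.2.1 ?_ ?_)⟩ <;>
    simp only [Prod.fst_sub, Prod.snd_sub] <;> omega

lemma card_sdiff_hasLeft (S : Finset Box) : (S \ hasLeft S).card = rowsOf S := by
  have hmem : ∀ x, x ∈ S \ hasLeft S ↔ x ∈ S ∧ ∀ a ∈ S, a.1 = x.1 → x.2 ≤ a.2 := by
    intro x
    rw [Finset.mem_sdiff, hasLeft, Finset.mem_filter]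
    constructor
    · rintro ⟨h1, h2⟩
      exact ⟨h1, fun a ha h => not_lt.1 fun h' => h2 ⟨h1, a, ha, h, h'⟩⟩
    · rintro ⟨h1, h2⟩
      exact ⟨h1, fun ⟨_, a, ha, h, h'⟩ => (h2 a ha h).not_gt h'⟩
  have himage : S.image Prod.fst = (S \ hasLeft S).image Prod.fst := by
    refine subset_antisymm (fun r hr => ?_) (Finset.image_subset_image Finset.sdiff_subset)
    obtain ⟨y, hy, rfl⟩ := Finset.mem_image.1 hr
    obtain ⟨x, hx, hmin⟩ := (S.filter (fun a => a.1 = y.1)).exists_min_image Prod.snd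
      ⟨y, Finset.mem_filter.2 ⟨hy, rfl⟩⟩
    rw [Finset.mem_filter] at hx
    exact Finset.mem_image.2 ⟨x, (hmem x).2 ⟨hx.1, fun a ha h =>
      hmin a (Finset.mem_filter.2 ⟨ha, h.trans hx.2⟩)⟩, hx.2⟩
  rw [rowsOf, himage, Finset.card_image_of_injOn]
  intro x hx y hy hxy
  rw [Finset.mem_coe, hmem] at hx hy
  exact Prod.ext hxy (le_antisymm (hx.2 y hy.1 hxy.symm) (hy.2 x hx.1 hxy))

lemma primitivePairing_schurPoly_ribbon {S : Finset Box} {m : ℕ} (hS : IsRibbon S)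
    (hconn : IsConnectedShape S) (hm : S.card ≤ m) :
    primitivePairing m (schurPoly S m) = - (-1) ^ rowsOf S := by
  obtain ⟨hshape, hblock⟩ := hS
  obtain ⟨hne, hconn⟩ := hconn
  rw [primitivePairing_schurPoly hne hm]
  obtain ⟨x, hx, h1, h2⟩ := exists_lowest_leftmost hne
  have hxfree : x ∈ noBelow S \ hasLeft S := mem_noBelow_sdiff_hasLeft.2
    ⟨hx, fun a ha _ => (h1 a ha).not_gt, fun a ha h => (h2 a ha h).not_gt⟩
  have hNE : ∀ x ∈ noBelow S \ hasLeft S, ∀ y ∈ S, y.1 ≤ x.1 ∧ x.2 ≤ y.2 := by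
    intro x hx y hy
    obtain ⟨hxS, hb, hl⟩ := mem_noBelow_sdiff_hasLeft.1 hx
    have := hconn x hxS y hy
    induction this with
    | refl => exact ⟨le_rfl, le_rfl⟩
    | @tail y z _ hyz ih =>
      obtain ⟨hyS, hzS, hadj⟩ := hyz
      obtain ⟨ih1, ih2⟩ := ih hyS
      by_contra hcon
      by_cases hz : x.2 ≤ z.2
      · have hz1 : x.1 < z.1 := by
          by_contra h
          exact hcon ⟨not_lt.1 h, hz⟩
        refine hb (z.1, x.2) (hshape.mem_of_le_of_le hxS hzS ?_ ?_) rfl hz1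
        · exact Prod.le_def.2 ⟨hz1.le, le_rfl⟩
        · exact Prod.le_def.2 ⟨le_rfl, hz⟩
      · have hz1 : z.1 ≤ x.1 := by
          unfold AdjB at hadj
          omega
        refine hl (x.1, z.2) (hshape.mem_of_le_of_le hzS hxS ?_ ?_) rfl (not_le.1 hz)
        · exact Prod.le_def.2 ⟨hz1, le_rfl⟩
        · exact Prod.le_def.2 ⟨le_rfl, (not_le.1 hz).le⟩
  have hfree : noBelow S \ hasLeft S = {x} := by
    refine Finset.eq_singleton_iff_unique_mem.2 ⟨hxfree, fun y hy => ?_⟩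
    have h3 := hNE x hxfree y (mem_noBelow_sdiff_hasLeft.1 hy).1
    have h4 := hNE y hy x hx
    exact Prod.ext (by omega) (by omega)
  have hsub : hasLeft S ⊆ noBelow S := by
    intro y hy
    obtain ⟨hyS, a, ha, ha1, ha2⟩ := Finset.mem_filter.1 hy
    refine Finset.mem_filter.2 ⟨hyS, fun d hd hd1 hd2 => ?_⟩
    refine hblock y.1 (y.2 - 1) ⟨?_, ?_, ?_, ?_⟩
    · exact hshape.mem_of_le_of_le ha hyS (Prod.le_def.2 ⟨by simp; omega, by simp; omega⟩)
        (Prod.le_def.2 ⟨by simp, by simp⟩)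
    · simpa using hyS
    · exact hshape.mem_of_le_of_le ha hd (Prod.le_def.2 ⟨by simp; omega, by simp; omega⟩)
        (Prod.le_def.2 ⟨by simp; omega, by simp; omega⟩)
    · exact hshape.mem_of_le_of_le hyS hd (Prod.le_def.2 ⟨by simp, by simp⟩)
        (Prod.le_def.2 ⟨by simp; omega, by simp; omega⟩)
  have hxN : x ∉ hasLeft S := (Finset.mem_sdiff.1 hxfree).2
  have hins : noBelow S = insert x (hasLeft S) := by
    rw [← Finset.sdiff_union_of_subset hsub, hfree]
    rfl
  have hIcc : Finset.Icc (hasLeft S) (noBelow S) = {hasLeft S, insert x (hasLeft S)} := by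
    ext J
    rw [hins, Finset.mem_Icc, Finset.mem_insert, Finset.mem_singleton]
    constructor
    · rintro ⟨hN, hU⟩
      by_cases hxJ : x ∈ J
      · exact Or.inr (subset_antisymm hU (Finset.insert_subset hxJ hN))
      · exact Or.inl (subset_antisymm ((Finset.subset_insert_iff_of_notMem hxJ).1 hU) hN)
    · rintro (rfl | rfl)
      · exact ⟨le_rfl, Finset.subset_insert _ _⟩
      · exact ⟨Finset.subset_insert _ _, le_rfl⟩
  have hrows : (S \ hasLeft S).card = rowsOf S := card_sdiff_hasLeft S
  have hrows' : (S \ hasLeft S).card = (S \ insert x (hasLeft S)).card + 1 := by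
    rw [Finset.sdiff_insert, Finset.card_erase_add_one]
    exact Finset.mem_sdiff.2 ⟨hx, hxN⟩
  have hneq : hasLeft S ≠ insert x (hasLeft S) := fun h =>
    hxN (h.symm ▸ Finset.mem_insert_self x (hasLeft S))
  rw [hIcc, Finset.sum_pair hneq,
    Finset.card_insert_of_notMem hxN, ← hrows, hrows']
  push_cast
  ring

/-- A union of components of a shape contains a box with nothing to its left or below it. -/
lemma IsShape.exists_mem_noBelow_sdiff_hasLeft {S C : Finset Box} (hS : IsShape S) (hCS : C ⊆ S)
    (hC : C.Nonempty) (hclosed : ∀ a ∈ C, ∀ b ∈ S, AdjB a b → b ∈ C) :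
    ∃ x ∈ C, x ∈ noBelow S \ hasLeft S := by
  obtain ⟨x, hx, h1, h2⟩ := exists_lowest_leftmost hC
  refine ⟨x, hx, mem_noBelow_sdiff_hasLeft.2 ⟨hCS hx, fun a ha h h' => ?_, fun a ha h h' => ?_⟩⟩
  · have hb : ((x.1 + 1, x.2) : Box) ∈ S := hS.mem_of_le_of_le (hCS hx) ha
      (Prod.le_def.2 ⟨by simp, by simp⟩) (Prod.le_def.2 ⟨by simp; omega, by simp; omega⟩)
    have := h1 _ (hclosed x hx _ hb (by simp [AdjB]))
    simp at this
  · have hb : ((x.1, x.2 - 1) : Box) ∈ S := hS.mem_of_le_of_le ha (hCS hx)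
      (Prod.le_def.2 ⟨by simp; omega, by simp; omega⟩) (Prod.le_def.2 ⟨by simp, by simp⟩)
    have := h2 _ (hclosed x hx _ hb (by simp [AdjB])) rfl
    simp at this

lemma AdjB.symm {x y : Box} (h : AdjB x y) : AdjB y x := by
  unfold AdjB at *
  omega

lemma primitivePairing_schurPoly_eq_zero {S : Finset Box} {m : ℕ} (hne : S.Nonempty)
    (hS : IsShape S) (hm : S.card ≤ m) (hnot : ¬ (IsConnectedShape S ∧ NoTwoByTwo S)) :
    primitivePairing m (schurPoly S m) = 0 := by
  rw [primitivePairing_schurPoly hne hm]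
  by_cases hblock : NoTwoByTwo S
  · have hdis : ¬ IsConnectedShape S := fun h => hnot ⟨h, hblock⟩
    simp only [IsConnectedShape, hne, true_and, not_forall] at hdis
    obtain ⟨u, hu, v, hv, huv⟩ := hdis
    set C := S.filter (fun z => Relation.ReflTransGen (fun a b => a ∈ S ∧ b ∈ S ∧ AdjB a b) u z)
      with hCdef
    have hC : ∀ a ∈ C, ∀ b ∈ S, AdjB a b → b ∈ C := fun a ha b hb hab => by
      rw [hCdef, Finset.mem_filter] at ha ⊢
      exact ⟨hb, ha.2.tail ⟨ha.1, hb, hab⟩⟩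
    obtain ⟨x, hxC, hx⟩ := hS.exists_mem_noBelow_sdiff_hasLeft (Finset.filter_subset _ _)
      ⟨u, Finset.mem_filter.2 ⟨hu, .refl⟩⟩ hC
    obtain ⟨y, hyC, hy⟩ := hS.exists_mem_noBelow_sdiff_hasLeft (C := S \ C) Finset.sdiff_subset
      ⟨v, Finset.mem_sdiff.2 ⟨hv, fun h => huv (Finset.mem_filter.1 h).2⟩⟩
      (fun a ha b hb hab => by
        rw [Finset.mem_sdiff] at ha ⊢
        exact ⟨hb, fun h => ha.2 (hC b h a ha.1 hab.symm)⟩)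
    have hxy : x ≠ y := by
      rintro rfl
      exact (Finset.mem_sdiff.1 hyC).2 hxC
    rw [Finset.mem_sdiff] at hx hy
    have hcard : ∀ J ∈ Finset.Icc (hasLeft S) (noBelow S),
        (J.card : ℚ) * (-1) ^ (S \ J).card =
          ∑ z ∈ S, (if z ∈ J then (1 : ℚ) else 0) * (-1) ^ (S \ J).card := by
      intro J hJ
      have hJS : J ⊆ S := (Finset.mem_Icc.1 hJ).2.trans (Finset.filter_subset _ _)
      rw [← Finset.sum_mul, Finset.sum_boole, Finset.filter_mem_eq_inter,
        Finset.inter_eq_right.2 hJS]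
    rw [Finset.sum_congr rfl hcard, Finset.sum_comm]
    refine Finset.sum_eq_zero fun z _ => ?_
    by_cases hzx : z = x
    · refine sum_Icc_alternating_eq_zero S _ _ (Finset.filter_subset _ _) y hy.1 hy.2
        (fun J => if z ∈ J then (1 : ℚ) else 0) fun J _ => ?_
      simp [hzx, hxy]
    · refine sum_Icc_alternating_eq_zero S _ _ (Finset.filter_subset _ _) x hx.1 hx.2
        (fun J => if z ∈ J then (1 : ℚ) else 0) fun J _ => ?_
      simp [hzx]
  · rw [Finset.Icc_eq_empty, Finset.sum_empty]
    intro hle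
    simp only [NoTwoByTwo, not_forall, not_not] at hblock
    obtain ⟨r, c, h1, h2, h3, h4⟩ := hblock
    have hmem : ((r, c + 1) : Box) ∈ hasLeft S :=
      Finset.mem_filter.2 ⟨h2, (r, c), h1, rfl, by simp⟩
    exact (Finset.mem_filter.1 (hle hmem)).2 _ h4 rfl (by simp)

/-- Lemma "signed sum".
Fix `n ≥ 1` and let `B` be a connected-ribbon basis of degree `n` over `ℚ` (a finite
set of connected ribbons of size `n` whose Schur polynomials in `m ≥ n` variables are
linearly independent and span the homogeneous symmetric polynomials of degree `n`).
Let `lam` be a shape of size `n` that is not a connected ribbon.  If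
`s_lam = ∑_{b ∈ B} c b • s_b`, then `∑_{b ∈ B} (-1)^(rows b) * c b = 0`. -/
theorem statement4 (n m : ℕ) (hn : 1 ≤ n) (hm : n ≤ m)
    (B : Finset (Finset Box))
    (hB : ∀ b ∈ B, IsRibbon b ∧ IsConnectedShape b ∧ b.card = n)
    (hind : LinearIndependent ℚ (fun b : ↥B => schurPoly (b : Finset Box) m))
    (hspan : ∀ p : MvPolynomial (Fin m) ℚ, p.IsSymmetric → p.IsHomogeneous n →
      p ∈ Submodule.span ℚ (Set.range (fun b : ↥B => schurPoly (b : Finset Box) m)))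
    (lam : Finset Box) (hshape : IsShape lam) (hcard : lam.card = n)
    (hnotrib : ¬ (IsConnectedShape lam ∧ NoTwoByTwo lam))
    (c : Finset Box → ℚ)
    (hc : schurPoly lam m = ∑ b ∈ B, c b • schurPoly b m) :
    ∑ b ∈ B, (-1 : ℚ) ^ rowsOf b * c b = 0 := by
  have hne : lam.Nonempty := Finset.card_pos.1 (by omega)
  have h := congrArg (primitivePairing m) hc
  rw [primitivePairing_schurPoly_eq_zero hne hshape (by omega) hnotrib, map_sum] at h
  have hterm : ∀ b ∈ B, primitivePairing m (c b • schurPoly b m) =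
      - ((-1 : ℚ) ^ rowsOf b * c b) := fun b hb => by
    obtain ⟨h1, h2, h3⟩ := hB b hb
    rw [map_smul, primitivePairing_schurPoly_ribbon h1 h2 (by omega), smul_eq_mul]
    ring
  rw [Finset.sum_congr rfl hterm, Finset.sum_neg_distrib] at h
  linarith
end
end

section
/- Let α and β be connected ribbons of the same size with the same number of nonempty rows. If the skew Schur function of α equals c times the skew Schur function of β for some nonzero scalar c ∈ ℚ (as homogeneous symmetric polynomials in m ≥ |α| variables), then c = 1 and the two skew Schur functions are equal. -/
open scoped Classical

noncomputable section

/-- A shape is convex: it contains the northeast corner of the rectangle spanned by a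
northwest-to-southeast pair of rows and columns. -/
theorem IsShape.mem_corner {S : Finset Box} (hS : IsShape S) {r r' c c' : ℤ}
    (h₁ : ((r', c) : Box) ∈ S) (h₂ : ((r, c') : Box) ∈ S) (hr : r' ≤ r) (hcol : c ≤ c') :
    ((r', c') : Box) ∈ S := by
  obtain ⟨t, T, ⟨mu, lam, hmu, hlam, -, rfl⟩, rfl⟩ := hS
  simp only [translateS, Finset.mem_image, Finset.mem_sdiff] at h₁ h₂ ⊢
  obtain ⟨⟨a₁, a₂⟩, ⟨ha, ha'⟩, hae⟩ := h₁
  obtain ⟨⟨b₁, b₂⟩, ⟨hb, -⟩, hbe⟩ := h₂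
  rw [Prod.ext_iff] at hae hbe
  simp only [Prod.fst_add, Prod.snd_add] at hae hbe
  have ha0 := hlam _ ha
  have hb0 := hlam _ hb
  simp only at ha0 hb0
  refine ⟨(a₁, b₂), ⟨hb0.2.2 _ ha0.1 hb0.2.1 (by simp only; omega) le_rfl, fun hm => ?_⟩, ?_⟩
  · exact ha' ((hmu _ hm).2.2 _ ha0.1 ha0.2.1 le_rfl (by simp only; omega))
  · exact Prod.ext (by simp only [Prod.fst_add]; omega) (by simp only [Prod.snd_add]; omega)

/-- The boxes of `S` strictly above `b` in its column. -/
def boxesAbove (S : Finset Box) (b : ↥S) : Finset ↥S :=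
  Finset.univ.filter fun b' => (b' : Box).2 = (b : Box).2 ∧ (b' : Box).1 < (b : Box).1

theorem mem_boxesAbove {S : Finset Box} {b b' : ↥S} :
    b' ∈ boxesAbove S b ↔ (b' : Box).2 = (b : Box).2 ∧ (b' : Box).1 < (b : Box).1 := by
  simp [boxesAbove]

theorem card_boxesAbove_lt_card (S : Finset Box) (b : ↥S) : (boxesAbove S b).card < S.card := by
  rw [← Fintype.card_coe S]
  exact Finset.card_lt_univ_of_notMem (x := b) fun h => lt_irrefl _ (mem_boxesAbove.1 h).2

theorem card_boxesAbove_lt_of_above {S : Finset Box} {b b' : ↥S}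
    (hcol : (b : Box).2 = (b' : Box).2) (hrow : (b : Box).1 < (b' : Box).1) :
    (boxesAbove S b).card < (boxesAbove S b').card := by
  refine Finset.card_lt_card (Finset.ssubset_iff_of_subset ?_ |>.2 ⟨b, ?_, ?_⟩)
  · intro x hx
    rw [mem_boxesAbove] at hx ⊢
    exact ⟨hx.1.trans hcol, hx.2.trans hrow⟩
  · exact mem_boxesAbove.2 ⟨hcol, hrow⟩
  · exact fun h => lt_irrefl _ (mem_boxesAbove.1 h).2

theorem IsShape.card_boxesAbove_le {S : Finset Box} (hS : IsShape S) {b b' : ↥S}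
    (hrow : (b : Box).1 = (b' : Box).1) (hcol : (b : Box).2 ≤ (b' : Box).2) :
    (boxesAbove S b).card ≤ (boxesAbove S b').card := by
  have key : ∀ x ∈ boxesAbove S b, (((x : Box).1, (b' : Box).2) : Box) ∈ S := by
    intro x hx
    rw [mem_boxesAbove] at hx
    exact hS.mem_corner (c := (x : Box).2) (r := (b' : Box).1) x.2 b'.2 (by omega) (by omega)
  refine Finset.card_le_card_of_injOn
    (fun x => if hx : x ∈ boxesAbove S b then ⟨_, key x hx⟩ else x) ?_ ?_
  · intro x hx
    have hx' : x ∈ boxesAbove S b := hx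
    simp only [hx', dif_pos, Finset.mem_coe, mem_boxesAbove, true_and]
    rw [mem_boxesAbove] at hx'
    omega
  · intro x hx y hy hxy
    have hx' : x ∈ boxesAbove S b := hx
    have hy' : y ∈ boxesAbove S b := hy
    simp only [hx', hy', dif_pos, Subtype.mk.injEq, Prod.mk.injEq, and_true] at hxy
    rw [mem_boxesAbove] at hx' hy'
    exact Subtype.ext (Prod.ext hxy (hx'.1.trans hy'.1.symm))

/-- In a column-strict filling, every entry is at least the number of boxes above it. -/
theorem card_boxesAbove_le_of_strict {S : Finset Box} {m : ℕ} {g : ↥S → Fin m}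
    (hg : ∀ b b' : ↥S, (b : Box).2 = (b' : Box).2 → (b : Box).1 < (b' : Box).1 → g b < g b')
    (b : ↥S) : (boxesAbove S b).card ≤ (g b : ℕ) := by
  rw [← Finset.card_range (g b : ℕ)]
  refine Finset.card_le_card_of_injOn (fun x => (g x : ℕ)) ?_ ?_
  · intro x hx
    have hx' := mem_boxesAbove.1 hx
    simpa using hg x b hx'.1 hx'.2
  · intro x hx y hy hxy
    have hx' := mem_boxesAbove.1 hx
    have hy' := mem_boxesAbove.1 hy
    have hgxy : g x = g y := Fin.ext hxy
    have hcol := hx'.1.trans hy'.1.symm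
    rcases lt_trichotomy (x : Box).1 (y : Box).1 with hlt | heq | hlt
    · exact absurd hgxy (hg x y hcol hlt).ne
    · exact Subtype.ext (Prod.ext heq hcol)
    · exact absurd hgxy (hg y x hcol.symm hlt).ne'

/-- The lowest term of the principal specialization `xᵢ ↦ tⁱ` of the Schur polynomial of a
shape has coefficient `1`. -/
theorem IsShape.exists_lowest_coeff_schurPoly {S : Finset Box} (hS : IsShape S) {m : ℕ}
    (hm : S.card ≤ m) :
    ∃ N : ℕ,
      (MvPolynomial.aeval (fun i : Fin m => (Polynomial.X : Polynomial ℚ) ^ (i : ℕ))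
        (schurPoly S m)).coeff N = 1 ∧
      ∀ k < N, (MvPolynomial.aeval (fun i : Fin m => (Polynomial.X : Polynomial ℚ) ^ (i : ℕ))
        (schurPoly S m)).coeff k = 0 := by
  refine ⟨∑ b : ↥S, (boxesAbove S b).card, ?_, fun k hk => ?_⟩
  all_goals
    simp only [schurPoly, map_sum, map_prod, MvPolynomial.aeval_X, Finset.prod_pow_eq_pow_sum,
      Polynomial.finsetSum_coeff, Polynomial.coeff_X_pow]
  · let g₀ : ↥S → Fin m := fun b =>
      ⟨(boxesAbove S b).card, (card_boxesAbove_lt_card S b).trans_le hm⟩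
    rw [Finset.sum_eq_single g₀]
    · simp [g₀]
    · intro g hg hne
      refine if_neg fun hsum => hne ?_
      have hle := card_boxesAbove_le_of_strict (Finset.mem_filter.1 hg).2.2
      have := (Finset.sum_eq_sum_iff_of_le fun b _ => hle b).1 hsum
      exact funext fun b => Fin.ext (this b (Finset.mem_univ b)).symm
    · intro hg
      refine absurd (Finset.mem_filter.2 ⟨Finset.mem_univ _, ?_, ?_⟩) hg
      · exact fun b b' hrow hcol => hS.card_boxesAbove_le hrow hcol
      · exact fun b b' hcol hrow => card_boxesAbove_lt_of_above hcol hrow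
  · refine Finset.sum_eq_zero fun g hg => if_neg fun hsum => ?_
    have hle := card_boxesAbove_le_of_strict (Finset.mem_filter.1 hg).2.2
    have := Finset.sum_le_sum fun b (_ : b ∈ Finset.univ) => hle b
    omega

/-- Lemma "only multiple is 1".
If `α` and `β` are connected ribbons of the same size with the same number of nonempty
rows, and the Schur polynomial of `α` equals `c` times that of `β` (in `m ≥ |α|`
variables) for some nonzero `c : ℚ`, then `c = 1` and the two Schur polynomials are
equal. -/
theorem statement5 (α β : Finset Box)
    (hα : IsRibbon α ∧ IsConnectedShape α) (hβ : IsRibbon β ∧ IsConnectedShape β)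
    (hsize : α.card = β.card) (hrows : rowsOf α = rowsOf β)
    (m : ℕ) (hm : α.card ≤ m) (c : ℚ) (hc : c ≠ 0)
    (h : schurPoly α m = c • schurPoly β m) :
    c = 1 ∧ schurPoly α m = schurPoly β m := by
  obtain ⟨M, hM, hM'⟩ := hα.1.1.exists_lowest_coeff_schurPoly hm
  obtain ⟨N, hN, hN'⟩ := hβ.1.1.exists_lowest_coeff_schurPoly (hsize ▸ hm)
  have hc1 : c = 1 := by
    rw [h] at hM hM'
    simp only [map_smul, Polynomial.coeff_smul, smul_eq_mul] at hM hM'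
    rcases lt_trichotomy M N with hlt | rfl | hlt
    · simp [hN' M hlt] at hM
    · simpa [hN] using hM
    · exact absurd (by simpa [hN] using hM' N hlt) hc
  exact ⟨hc1, by rw [h, hc1, one_smul]⟩
end
end

section
/- Let γ be a W→O→W shape or a W↑O↑W shape. Then the top key ribbon of γ and the bottom key ribbon of γ have the same size (number of boxes), the same number of rows, and the same number of columns. -/
open scoped Classical

noncomputable section

/-- Consecutive diagonals met by `S` are joined by a pair of boxes of `S` sharing an edge. -/
def DiagConnected (S : Set Box) : Prop :=
  ∀ x ∈ S, ∀ y ∈ S, ∀ d : ℤ, diagB x ≤ d → d < diagB y →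
    ∃ s ∈ S, ∃ s' ∈ S, diagB s = d ∧ diagB s' = d + 1 ∧ (s'.1 = s.1 ∨ s'.1 = s.1 - 1)

theorem IsConnectedShape.diagConnected {S : Finset Box} (h : IsConnectedShape S) :
    DiagConnected (S : Set Box) := by
  intro x hx y hy d hxd hdy
  have key := h.2 x hx y hy
  clear hy
  induction key with
  | refl => omega
  | @tail z z' _ hzz ih =>
    obtain ⟨hz, hz', hadj⟩ := hzz
    by_cases hd : d < diagB z
    · exact ih hd
    · refine ⟨z, hz, z', hz', ?_⟩
      simp only [diagB, AdjB] at *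
      omega

theorem IsShape.ordConnected {S : Finset Box} (h : IsShape S) :
    (S : Set Box).OrdConnected := by
  obtain ⟨t, T, ⟨mu, lam, hmu, hlam, -, rfl⟩, rfl⟩ := h
  refine ⟨?_⟩
  rintro x hx y hy z ⟨hxz, hzy⟩
  simp only [translateS, Finset.coe_image, Set.mem_image, Finset.mem_coe, Finset.mem_sdiff]
    at hx hy ⊢
  obtain ⟨x, ⟨hx, hx'⟩, rfl⟩ := hx
  obtain ⟨y, ⟨hy, hy'⟩, rfl⟩ := hy
  have h1 := Prod.le_def.1 hxz
  have h2 := Prod.le_def.1 hzy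
  simp only [Prod.fst_add, Prod.snd_add] at h1 h2
  have h3 := hlam x hx
  refine ⟨z - t, ⟨(hlam y hy).2.2 _ ?_ ?_ ?_ ?_, fun hz => hx' ?_⟩, by abel⟩
  any_goals simp only [Prod.fst_sub, Prod.snd_sub]; omega
  refine (hmu _ hz).2.2 _ h3.1 h3.2.1 ?_ ?_ <;>
    simp only [Prod.fst_sub, Prod.snd_sub] <;> omega

theorem Set.OrdConnected.box_mem {S : Set Box} (h : S.OrdConnected) {x y : Box} (hx : x ∈ S)
    (hy : y ∈ S) {r c : ℤ} (h₁ : x.1 ≤ r) (h₂ : r ≤ y.1) (h₃ : x.2 ≤ c) (h₄ : c ≤ y.2) :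
    ((r, c) : Box) ∈ S :=
  h.out hx hy ⟨⟨h₁, h₃⟩, ⟨h₂, h₄⟩⟩

/-- In an order-convex set, a comparable pair leaving `P` can be refined to a covering pair. -/
theorem exists_covering_pair {G : Set Box} (hG : G.OrdConnected) (P : Set Box) (n : ℕ) :
    ∀ {x y : Box}, x ∈ G → y ∈ G → x ∈ P → y ∉ P → x.1 ≤ y.1 → x.2 ≤ y.2 →
      (y.1 - x.1) + (y.2 - x.2) = n →
      ∃ x' ∈ G, ∃ y' ∈ G, x' ∈ P ∧ y' ∉ P ∧
        (y'.1 = x'.1 + 1 ∧ y'.2 = x'.2 ∨ y'.1 = x'.1 ∧ y'.2 = x'.2 + 1) := by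
  induction n with
  | zero =>
    intro x y _ _ hxP hyP h1 h2 hn
    have : x = y := Prod.ext (by omega) (by omega)
    exact absurd (this ▸ hxP) hyP
  | succ n ih =>
    intro x y hx hy hxP hyP h1 h2 hn
    push_cast at hn
    by_cases h : x.1 < y.1
    · have hm : ((x.1 + 1, x.2) : Box) ∈ G := hG.box_mem hx hy (by omega) h le_rfl h2
      by_cases hP : ((x.1 + 1, x.2) : Box) ∈ P
      · exact ih hm hy hP hyP h h2 (by dsimp only; omega)
      · exact ⟨x, hx, _, hm, hxP, hP, by simp⟩
    · have hm : ((x.1, x.2 + 1) : Box) ∈ G :=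
        hG.box_mem hx hy le_rfl h1 (by omega) (by omega)
      by_cases hP : ((x.1, x.2 + 1) : Box) ∈ P
      · exact ih hm hy hP hyP h1 (by dsimp only; omega) (by dsimp only; omega)
      · exact ⟨x, hx, _, hm, hxP, hP, by simp⟩

section OneSided

variable {W C : Set Box}

theorem not_sandwiched (hW : W.OrdConnected) (hd : Disjoint W C) {w c w' : Box} (hw : w ∈ W)
    (hc : c ∈ C) (hw' : w' ∈ W) (h₁ : w.1 ≤ c.1) (h₂ : w.2 ≤ c.2) (h₃ : c.1 ≤ w'.1)
    (h₄ : c.2 ≤ w'.2) : False :=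
  Set.disjoint_left.1 hd (hW.box_mem hw hw' h₁ h₃ h₂ h₄) hc

theorem one_sided_of_diagB_eq (hW : W.OrdConnected) (hC : C.OrdConnected) (hd : Disjoint W C)
    {w₀ c₀ c₁ w₁ : Box} (hw₀ : w₀ ∈ W) (hc₀ : c₀ ∈ C) (hc₁ : c₁ ∈ C) (hw₁ : w₁ ∈ W)
    (h₀ : w₀.1 ≤ c₀.1 ∧ w₀.2 ≤ c₀.2) (h₁ : c₁.1 ≤ w₁.1 ∧ c₁.2 ≤ w₁.2)
    (h : diagB c₁ = diagB w₁) (h' : diagB w₀ = diagB w₁ ∨ diagB c₀ = diagB w₁) : False := by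
  simp only [diagB] at h h'
  rcases h' with h' | h'
  · rcases le_total w₀.1 c₁.1 with hr | hr
    · exact not_sandwiched hW hd hw₀ hc₁ hw₁ hr (by omega) h₁.1 h₁.2
    · exact not_sandwiched hC hd.symm hc₁ hw₀ hc₀ hr (by omega) h₀.1 h₀.2
  · rcases le_total c₀.1 w₁.1 with hr | hr
    · exact not_sandwiched hW hd hw₀ hc₀ hw₁ h₀.1 h₀.2 hr (by omega)
    · exact not_sandwiched hC hd.symm hc₁ hw₁ hc₀ h₁.1 h₁.2 hr (by omega)

theorem one_sided_of_covering (hW : W.OrdConnected) (hC : C.OrdConnected) (hd : Disjoint W C)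
    (cW : DiagConnected W) (cC : DiagConnected C) {w₀ c₀ c₁ w₁ : Box}
    (hw₀ : w₀ ∈ W) (hc₀ : c₀ ∈ C) (hc₁ : c₁ ∈ C) (hw₁ : w₁ ∈ W)
    (h₀ : c₀.1 = w₀.1 + 1 ∧ c₀.2 = w₀.2 ∨ c₀.1 = w₀.1 ∧ c₀.2 = w₀.2 + 1)
    (h₁ : w₁.1 = c₁.1 + 1 ∧ w₁.2 = c₁.2 ∨ w₁.1 = c₁.1 ∧ w₁.2 = c₁.2 + 1)
    (hle : min (diagB w₀) (diagB c₀) ≤ min (diagB c₁) (diagB w₁)) : False := by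
  have h₀' : w₀.1 ≤ c₀.1 ∧ w₀.2 ≤ c₀.2 := by omega
  have h₁' : c₁.1 ≤ w₁.1 ∧ c₁.2 ≤ w₁.2 := by omega
  have hd₀ : diagB c₀ = diagB w₀ - 1 ∨ diagB c₀ = diagB w₀ + 1 := by
    simp only [diagB]; omega
  have hd₁ : diagB w₁ = diagB c₁ - 1 ∨ diagB w₁ = diagB c₁ + 1 := by
    simp only [diagB]; omega
  by_cases hnear : min (diagB c₁) (diagB w₁) ≤ min (diagB w₀) (diagB c₀) + 1
  · have e1 : ¬ (w₀.1 ≤ c₁.1 ∧ w₀.2 ≤ c₁.2) := fun h =>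
      not_sandwiched hW hd hw₀ hc₁ hw₁ h.1 h.2 h₁'.1 h₁'.2
    have e2 : ¬ (c₁.1 ≤ w₀.1 ∧ c₁.2 ≤ w₀.2) := fun h =>
      not_sandwiched hC hd.symm hc₁ hw₀ hc₀ h.1 h.2 h₀'.1 h₀'.2
    have e3 : ¬ (c₀.1 ≤ w₁.1 ∧ c₀.2 ≤ w₁.2) := fun h =>
      not_sandwiched hW hd hw₀ hc₀ hw₁ h₀'.1 h₀'.2 h.1 h.2
    have e4 : ¬ (w₁.1 ≤ c₀.1 ∧ w₁.2 ≤ c₀.2) := fun h =>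
      not_sandwiched hC hd.symm hc₁ hw₁ hc₀ h₁'.1 h₁'.2 h.1 h.2
    simp only [diagB] at hle hnear
    clear hd₀ hd₁ h₀' h₁'
    rcases h₀ with h₀ | h₀ <;> rcases h₁ with h₁ | h₁ <;> simp only [h₀, h₁] at * <;> omega
  obtain ⟨u, hu⟩ : ∃ u, u = min (diagB w₀) (diagB c₀) + 1 := ⟨_, rfl⟩
  obtain ⟨t, ht⟩ : ∃ t, t = min (diagB c₁) (diagB w₁) := ⟨_, rfl⟩
  have hrow : ∀ n : ℕ, u + n ≤ t → ∀ w ∈ W, ∀ c ∈ C, diagB w = u + n → diagB c = u + n →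
      w.1 < c.1 := by
    intro n
    induction n with
    | zero =>
      intro _ w hw c hc hwd hcd
      by_contra hlt
      refine one_sided_of_diagB_eq hW hC hd hw₀ hc₀ hc hw h₀' ?_ (by omega) (by omega)
      simp only [diagB] at hwd hcd
      omega
    | succ n ih =>
      intro hn w hw c hc hwd hcd
      push_cast at hn hwd hcd
      obtain ⟨s, hs, s', hs', hsd, hsd', hss⟩ := cW w₀ hw₀ w₁ hw₁ (u + n) (by omega) (by omega)
      obtain ⟨q, hq, q', hq', hqd, hqd', hqq⟩ := cC c₀ hc₀ c₁ hc₁ (u + n) (by omega) (by omega)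
      have hsq := ih (by omega) s hs q hq hsd hqd
      by_contra hlt
      refine one_sided_of_diagB_eq hW hC hd hs' hq' hc hw ?_ ?_ (by omega) (by omega)
      · simp only [diagB] at hsd' hqd'
        omega
      · simp only [diagB] at hwd hcd
        omega
  have hlast := hrow (t - u).toNat (by omega)
  rcases Int.le_total (diagB c₁) (diagB w₁) with h | h
  · obtain ⟨-, -, s', hs', -, hsd', -⟩ := cW w₀ hw₀ w₁ hw₁ (t - 1) (by omega) (by omega)
    have f1 := hlast s' hs' c₁ hc₁ (by omega) (by omega)
    refine not_sandwiched hW hd hs' hc₁ hw₁ f1.le ?_ h₁'.1 h₁'.2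
    simp only [diagB] at *
    omega
  · obtain ⟨-, -, s', hs', -, hsd', -⟩ := cC c₀ hc₀ c₁ hc₁ (t - 1) (by omega) (by omega)
    have f1 := hlast w₁ hw₁ s' hs' (by omega) (by omega)
    refine not_sandwiched hC hd.symm hc₁ hw₁ hs' h₁'.1 h₁'.2 f1.le ?_
    simp only [diagB] at *
    omega

/-- If an order-convex set is split into two order-convex diagonally connected parts, then all
comparabilities between the two parts go in the same direction. -/
theorem one_sided (hW : W.OrdConnected) (hC : C.OrdConnected) (hWC : (W ∪ C).OrdConnected)
    (hd : Disjoint W C) (cW : DiagConnected W) (cC : DiagConnected C) {w₀ c₀ c₁ w₁ : Box}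
    (hw₀ : w₀ ∈ W) (hc₀ : c₀ ∈ C) (hc₁ : c₁ ∈ C) (hw₁ : w₁ ∈ W)
    (h₀ : w₀ ≤ c₀) (h₁ : c₁ ≤ w₁) : False := by
  have h₀ := Prod.le_def.1 h₀
  have h₁ := Prod.le_def.1 h₁
  obtain ⟨w₀, hw₀', c₀, hc₀', hw₀, hc₀, h₀⟩ := exists_covering_pair hWC W
    (c₀.1 - w₀.1 + (c₀.2 - w₀.2)).toNat (.inl hw₀) (.inr hc₀) hw₀
    (Set.disjoint_right.1 hd hc₀) h₀.1 h₀.2 (by omega)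
  obtain ⟨c₁, hc₁', w₁, hw₁', hc₁, hw₁, h₁⟩ := exists_covering_pair hWC C
    (w₁.1 - c₁.1 + (w₁.2 - c₁.2)).toNat (.inr hc₁) (.inl hw₁) hc₁
    (Set.disjoint_left.1 hd hw₁) h₁.1 h₁.2 (by omega)
  replace hc₀ := hc₀'.resolve_left hc₀
  replace hw₁ := hw₁'.resolve_right hw₁
  rcases le_total (min (diagB w₀) (diagB c₀)) (min (diagB c₁) (diagB w₁)) with h | h
  · exact one_sided_of_covering hW hC hd cW cC hw₀ hc₀ hc₁ hw₁ h₀ h₁ h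
  · exact one_sided_of_covering hC hW hd.symm cC cW hc₁ hw₁ hw₀ hc₀ h₁ h₀ h

end OneSided

/-- The data of a `W → O → W` shape (for `δ = (0, 1)`) or of a `W ↑ O ↑ W` shape (for
`δ = (-1, 0)`) used for comparing its key ribbons: `a` and `b` are the southwesternmost and the
northeasternmost boxes of `O`. -/
structure OverlapData (γ Wlow Wup : Set Box) (v δ a b : Box) : Prop where
  ordConnected : γ.OrdConnected
  ordConnected_low : Wlow.OrdConnected
  ordConnected_up : Wup.OrdConnected
  ordConnected_diff_low : (γ \ Wlow).OrdConnected
  ordConnected_diff_up : (γ \ Wup).OrdConnected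
  diagConnected_low : DiagConnected Wlow
  diagConnected_up : DiagConnected Wup
  diagConnected_diff_low : DiagConnected (γ \ Wlow)
  diagConnected_diff_up : DiagConnected (γ \ Wup)
  low_subset : Wlow ⊆ γ
  up_subset : Wup ⊆ γ
  mem_up : ∀ x, x ∈ Wup ↔ x - v ∈ Wlow
  separated : ∃ k : ℤ, (∀ x ∈ Wlow, diagB x < k) ∧ ∀ x ∈ Wup, k < diagB x
  exists_sw : ∃ s ∈ Wlow, ∀ x ∈ γ, x.1 ≤ s.1 ∧ s.2 ≤ x.2
  exists_ne : ∃ e ∈ Wup, ∀ x ∈ γ, e.1 ≤ x.1 ∧ x.2 ≤ e.2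
  mem_a : a ∈ γ \ (Wlow ∪ Wup)
  mem_b : b ∈ γ \ (Wlow ∪ Wup)
  sw_a : ∀ x ∈ γ \ (Wlow ∪ Wup), x.1 ≤ a.1 ∧ a.2 ≤ x.2
  ne_b : ∀ x ∈ γ \ (Wlow ∪ Wup), b.1 ≤ x.1 ∧ x.2 ≤ b.2
  sub_mem_low : a - δ ∈ Wlow
  add_mem_up : b + δ ∈ Wup

theorem DiagConnected.neg {S : Set Box} (h : DiagConnected S) : DiagConnected {x | -x ∈ S} := by
  intro x hx y hy d h₁ h₂
  obtain ⟨s, hs, s', hs', hd, hd', hss⟩ := h (-y) hy (-x) hx (-d - 1)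
    (by simp only [diagB, Prod.fst_neg, Prod.snd_neg] at *; omega)
    (by simp only [diagB, Prod.fst_neg, Prod.snd_neg] at *; omega)
  refine ⟨-s', by simpa using hs', -s, by simpa using hs, ?_⟩
  simp only [diagB, Prod.fst_neg, Prod.snd_neg] at *
  omega

theorem ordConnected_neg {S : Set Box} (h : S.OrdConnected) :
    {x : Box | -x ∈ S}.OrdConnected :=
  ⟨fun _ hx _ hy _ hz => h.out hy hx ⟨neg_le_neg hz.2, neg_le_neg hz.1⟩⟩

/-- The reflection of the plane in an antidiagonal, exchanging the directions east and north. -/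
def flipBox (b : Box) : Box := (-b.2, -b.1)

@[simp] theorem flipBox_flipBox (b : Box) : flipBox (flipBox b) = b := by simp [flipBox]

theorem flipBox_injective : Function.Injective flipBox :=
  Function.LeftInverse.injective flipBox_flipBox

theorem flipBox_sub (x y : Box) : flipBox (x - y) = flipBox x - flipBox y := by
  simp only [flipBox, Prod.fst_sub, Prod.snd_sub, Prod.mk_sub_mk, Prod.mk.injEq]
  omega

theorem flipBox_add (x y : Box) : flipBox (x + y) = flipBox x + flipBox y := by
  simp only [flipBox, Prod.fst_add, Prod.snd_add, Prod.mk_add_mk, Prod.mk.injEq]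
  omega

@[simp] theorem diagB_flipBox (x : Box) : diagB (flipBox x) = diagB x := by
  simp only [diagB, flipBox]
  omega

theorem DiagConnected.flip {S : Set Box} (h : DiagConnected S) :
    DiagConnected {x | flipBox x ∈ S} := by
  intro x hx y hy d h₁ h₂
  obtain ⟨s, hs, s', hs', hd, hd', hss⟩ := h _ hx _ hy d (by simpa) (by simpa)
  refine ⟨flipBox s, by simpa using hs, flipBox s', by simpa using hs', by simpa, by simpa, ?_⟩
  simp only [diagB, flipBox] at *
  omega

theorem ordConnected_flip {S : Set Box} (h : S.OrdConnected) :
    {x : Box | flipBox x ∈ S}.OrdConnected :=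
  ⟨fun _ hx _ hy _ hz => h.out hy hx
    ⟨⟨neg_le_neg hz.2.2, neg_le_neg hz.2.1⟩, ⟨neg_le_neg hz.1.2, neg_le_neg hz.1.1⟩⟩⟩

/-- The union of `γ` and of its translate by `v`. -/
def amalgam (γ : Set Box) (v : Box) : Set Box := {x | x ∈ γ ∨ x - v ∈ γ}

namespace OverlapData

variable {γ Wlow Wup : Set Box} {v δ a b : Box}

theorem neg (h : OverlapData γ Wlow Wup v δ a b) :
    OverlapData {x | -x ∈ γ} {x | -x ∈ Wup} {x | -x ∈ Wlow} v δ (-b) (-a) where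
  ordConnected := ordConnected_neg h.ordConnected
  ordConnected_low := ordConnected_neg h.ordConnected_up
  ordConnected_up := ordConnected_neg h.ordConnected_low
  ordConnected_diff_low := ordConnected_neg h.ordConnected_diff_up
  ordConnected_diff_up := ordConnected_neg h.ordConnected_diff_low
  diagConnected_low := h.diagConnected_up.neg
  diagConnected_up := h.diagConnected_low.neg
  diagConnected_diff_low := h.diagConnected_diff_up.neg
  diagConnected_diff_up := h.diagConnected_diff_low.neg
  low_subset _ hx := h.up_subset hx
  up_subset _ hx := h.low_subset hx
  mem_up x := by
    have := h.mem_up (-(x - v))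
    rw [neg_sub, sub_sub_cancel_left] at this
    simp only [Set.mem_ofPred_eq, neg_sub]
    exact this.symm
  separated := by
    obtain ⟨k, h₁, h₂⟩ := h.separated
    refine ⟨-k, fun x hx => ?_, fun x hx => ?_⟩
    · have := h₂ _ hx
      simp only [diagB, Prod.fst_neg, Prod.snd_neg] at *
      omega
    · have := h₁ _ hx
      simp only [diagB, Prod.fst_neg, Prod.snd_neg] at *
      omega
  exists_sw := by
    obtain ⟨e, he, hγ⟩ := h.exists_ne
    refine ⟨-e, by simpa using he, fun x hx => ?_⟩
    have := hγ _ hx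
    simp only [Prod.fst_neg, Prod.snd_neg] at *
    omega
  exists_ne := by
    obtain ⟨e, he, hγ⟩ := h.exists_sw
    refine ⟨-e, by simpa using he, fun x hx => ?_⟩
    have := hγ _ hx
    simp only [Prod.fst_neg, Prod.snd_neg] at *
    omega
  mem_a := by simpa [and_comm] using h.mem_b
  mem_b := by simpa [and_comm] using h.mem_a
  sw_a x hx := by
    have := h.ne_b (-x) (by simpa [and_comm] using hx)
    simp only [Prod.fst_neg, Prod.snd_neg] at *
    omega
  ne_b x hx := by
    have := h.sw_a (-x) (by simpa [and_comm] using hx)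
    simp only [Prod.fst_neg, Prod.snd_neg] at *
    omega
  sub_mem_low := by simpa [add_comm] using h.add_mem_up
  add_mem_up := by
    have := h.sub_mem_low
    simpa [sub_eq_add_neg, add_comm] using this

theorem flip (h : OverlapData γ Wlow Wup v δ a b) :
    OverlapData {x | flipBox x ∈ γ} {x | flipBox x ∈ Wlow} {x | flipBox x ∈ Wup}
      (flipBox v) (flipBox δ) (flipBox a) (flipBox b) where
  ordConnected := ordConnected_flip h.ordConnected
  ordConnected_low := ordConnected_flip h.ordConnected_low
  ordConnected_up := ordConnected_flip h.ordConnected_up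
  ordConnected_diff_low := ordConnected_flip h.ordConnected_diff_low
  ordConnected_diff_up := ordConnected_flip h.ordConnected_diff_up
  diagConnected_low := h.diagConnected_low.flip
  diagConnected_up := h.diagConnected_up.flip
  diagConnected_diff_low := h.diagConnected_diff_low.flip
  diagConnected_diff_up := h.diagConnected_diff_up.flip
  low_subset _ hx := h.low_subset hx
  up_subset _ hx := h.up_subset hx
  mem_up x := by simpa [flipBox_sub] using h.mem_up (flipBox x)
  separated := by
    obtain ⟨k, h₁, h₂⟩ := h.separated
    exact ⟨k, fun x hx => by simpa using h₁ _ hx, fun x hx => by simpa using h₂ _ hx⟩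
  exists_sw := by
    obtain ⟨e, he, hγ⟩ := h.exists_sw
    refine ⟨flipBox e, by simpa using he, fun x hx => ?_⟩
    have := hγ _ hx
    simp only [flipBox] at *
    omega
  exists_ne := by
    obtain ⟨e, he, hγ⟩ := h.exists_ne
    refine ⟨flipBox e, by simpa using he, fun x hx => ?_⟩
    have := hγ _ hx
    simp only [flipBox] at *
    omega
  mem_a := by simpa using h.mem_a
  mem_b := by simpa using h.mem_b
  sw_a x hx := by
    have := h.sw_a (flipBox x) (by simpa using hx)
    simp only [flipBox] at *
    omega
  ne_b x hx := by
    have := h.ne_b (flipBox x) (by simpa using hx)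
    simp only [flipBox] at *
    omega
  sub_mem_low := by simpa [flipBox_sub] using h.sub_mem_low
  add_mem_up := by simpa [flipBox_add] using h.add_mem_up

/-- In the `W → O → W` case, no box of `γ` outside the lower copy of `W` is weakly northwest of
a box of that copy. -/
theorem not_le_low (h : OverlapData γ Wlow Wup v (0, 1) a b) {x w : Box} (hx : x ∈ γ)
    (hx' : x ∉ Wlow) (hw : w ∈ Wlow) : ¬ x ≤ w := fun hxw =>
  one_sided h.ordConnected_low h.ordConnected_diff_low
    (by rw [Set.union_sdiff_cancel h.low_subset]; exact h.ordConnected) Set.disjoint_sdiff_right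
    h.diagConnected_low h.diagConnected_diff_low h.sub_mem_low
    ⟨h.mem_a.1, fun ha => h.mem_a.2 (.inl ha)⟩ ⟨hx, hx'⟩ hw
    (sub_le_self _ ⟨le_rfl, zero_le_one⟩) hxw

/-- In the `W → O → W` case, no box of `γ` outside the upper copy of `W` is weakly southeast of
a box of that copy. -/
theorem not_up_le (h : OverlapData γ Wlow Wup v (0, 1) a b) {x w : Box} (hx : x ∈ γ)
    (hx' : x ∉ Wup) (hw : w ∈ Wup) : ¬ w ≤ x := fun hwx =>
  one_sided h.ordConnected_up h.ordConnected_diff_up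
    (by rw [Set.union_sdiff_cancel h.up_subset]; exact h.ordConnected) Set.disjoint_sdiff_right
    h.diagConnected_up h.diagConnected_diff_up hw ⟨hx, hx'⟩
    ⟨h.mem_b.1, fun hb => h.mem_b.2 (.inr hb)⟩ h.add_mem_up hwx
    (le_add_of_nonneg_right ⟨le_rfl, zero_le_one⟩)

theorem exists_extreme_diagB (h : OverlapData γ Wlow Wup v (0, 1) a b) :
    ∃ p ∈ Wup, ∃ q ∈ Wup, (∀ x ∈ γ, diagB x ≤ diagB q) ∧ ∀ x, x - v ∈ γ → diagB p ≤ diagB x := by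
  obtain ⟨s, hs, hs'⟩ := h.exists_sw
  obtain ⟨e, he, he'⟩ := h.exists_ne
  refine ⟨s + v, (h.mem_up _).2 (by simpa), e, he, fun x hx => ?_, fun x hx => ?_⟩
  · have := he' x hx
    simp only [diagB]
    omega
  · have := hs' _ hx
    simp only [diagB, Prod.fst_sub, Prod.snd_sub, Prod.fst_add, Prod.snd_add] at *
    omega

theorem exists_mem_diagB_eq {S : Set Box} (hS : DiagConnected S) {p q : Box} (hp : p ∈ S)
    (hq : q ∈ S) {d : ℤ} (h₁ : diagB p ≤ d) (h₂ : d ≤ diagB q) : ∃ w ∈ S, diagB w = d := by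
  rcases h₂.lt_or_eq with h₂ | rfl
  · obtain ⟨s, hs, -, -, hd, -⟩ := hS p hp q hq d h₁ h₂
    exact ⟨s, hs, hd⟩
  · exact ⟨q, hq, rfl⟩

/-- In the `W → O → W` case, the amalgamation is order-convex. -/
theorem ordConnected_amalgam (h : OverlapData γ Wlow Wup v (0, 1) a b) :
    (amalgam γ v).OrdConnected := by
  have hG := h.ordConnected
  have hH : {x : Box | x - v ∈ γ}.OrdConnected :=
    ⟨fun x hx y hy z hz => hG.out hx hy ⟨sub_le_sub_right hz.1 v, sub_le_sub_right hz.2 v⟩⟩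
  have hWG : ∀ w ∈ Wup, w ∈ γ := fun w hw => h.up_subset hw
  have hWH : ∀ w ∈ Wup, w ∈ {x : Box | x - v ∈ γ} := fun w hw => h.low_subset ((h.mem_up w).1 hw)
  have hGW : ∀ x ∈ γ, ∀ w ∈ Wup, w ≤ x → x ∈ Wup := fun x hx w hw hwx => by
    by_contra hx'
    exact h.not_up_le hx hx' hw hwx
  have hHW : ∀ x ∈ {x : Box | x - v ∈ γ}, ∀ w ∈ Wup, x ≤ w → x ∈ Wup := fun x hx w hw hxw => by
    by_contra hx'
    exact h.not_le_low hx (fun hl => hx' ((h.mem_up x).2 hl)) ((h.mem_up w).1 hw)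
      (sub_le_sub_right hxw v)
  obtain ⟨p, hp, q, hq, hGq, hHp⟩ := h.exists_extreme_diagB
  change ∀ x ∈ {x : Box | x - v ∈ γ}, diagB p ≤ diagB x at hHp
  have hW : ∀ d, diagB p ≤ d → d ≤ diagB q → ∃ w ∈ Wup, diagB w = d := fun d h₁ h₂ =>
    exists_mem_diagB_eq h.diagConnected_up hp hq h₁ h₂
  change ({x | x ∈ γ ∨ x ∈ {x : Box | x - v ∈ γ}} : Set Box).OrdConnected
  generalize {x : Box | x - v ∈ γ} = H at *
  have total : ∀ x y : Box, diagB x = diagB y → x ≤ y ∨ y ≤ x := fun x y hxy => by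
    simp only [diagB, Prod.le_def] at *
    omega
  have hGH : ∀ x ∈ γ, ∀ y ∈ H, ∀ z, x ≤ z → z ≤ y → diagB p ≤ diagB z → diagB z ≤ diagB q →
      z ∈ γ ∨ z ∈ H := fun x hx y hy z hxz hzy h₁ h₂ => by
    obtain ⟨w, hw, hwz⟩ := hW _ h₁ h₂
    rcases total w z hwz with hle | hle
    · exact .inr (hH.out (hWH w hw) hy ⟨hle, hzy⟩)
    · exact .inl (hG.out hx (hWG w hw) ⟨hxz, hle⟩)
  refine ⟨fun x hx y hy z hz => ?_⟩
  obtain ⟨hxz, hzy⟩ := hz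
  rcases hx with hx | hx <;> rcases hy with hy | hy
  · exact .inl (hG.out hx hy ⟨hxz, hzy⟩)
  · have hpy := hHp y hy
    have hxq := hGq x hx
    rcases lt_or_ge (diagB z) (diagB p) with hzp | hzp
    · obtain ⟨w, hw, hwp⟩ := hW _ le_rfl (hGq p (hWG p hp))
      obtain ⟨z', hz'⟩ : ∃ z' : Box, z' = (z.1, z.1 + diagB p) := ⟨_, rfl⟩
      have hzz' : z ≤ z' := by
        simp only [hz', diagB, Prod.le_def] at *
        omega
      have hzy' : z' ≤ y := by
        simp only [hz', diagB, Prod.le_def] at *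
        omega
      have hdz' : diagB z' = diagB p := by simp [hz', diagB]
      rcases total z' w (hdz'.trans hwp.symm) with hle | hle
      · exact .inl (hG.out hx (hWG w hw) ⟨hxz, hzz'.trans hle⟩)
      rcases eq_or_ne z' w with rfl | hne
      · exact .inl (hG.out hx (hWG _ hw) ⟨hxz, hzz'⟩)
      have hlt : w.1 < z'.1 := by
        by_contra hcon
        refine hne (Prod.ext ?_ ?_) <;>
        · simp only [diagB, Prod.le_def] at *
          omega
      have hm : ((w.1 + 1, w.2) : Box) ∈ H := by
        refine hH.box_mem (hWH w hw) hy (by omega) ?_ le_rfl ?_ <;>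
        · simp only [diagB, Prod.le_def] at *
          omega
      have := hHp _ hm
      simp only [diagB] at *
      omega
    rcases lt_or_ge (diagB q) (diagB z) with hzq | hzq
    · obtain ⟨w, hw, hwq⟩ := hW _ (hHp q (hWH q hq)) le_rfl
      obtain ⟨z', hz'⟩ : ∃ z' : Box, z' = (z.1, z.1 + diagB q) := ⟨_, rfl⟩
      have hzz' : z' ≤ z := by
        simp only [hz', diagB, Prod.le_def] at *
        omega
      have hxz' : x ≤ z' := by
        simp only [hz', diagB, Prod.le_def] at *
        omega
      have hdz' : diagB z' = diagB q := by simp [hz', diagB]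
      rcases total w z' (hwq.trans hdz'.symm) with hle | hle
      · exact .inr (hH.out (hWH w hw) hy ⟨hle.trans hzz', hzy⟩)
      rcases eq_or_ne z' w with rfl | hne
      · exact .inr (hH.out (hWH _ hw) hy ⟨hzz', hzy⟩)
      have hlt : z'.1 < w.1 := by
        by_contra hcon
        refine hne (Prod.ext ?_ ?_) <;>
        · simp only [diagB, Prod.le_def] at *
          omega
      have hm : ((w.1 - 1, w.2) : Box) ∈ γ := by
        refine hG.box_mem hx (hWG w hw) ?_ (by omega) ?_ le_rfl <;>
        · simp only [diagB, Prod.le_def] at *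
          omega
      have := hGq _ hm
      simp only [diagB] at *
      omega
    · exact hGH x hx y hy z hxz hzy hzp hzq
  · suffices hxy : x ∈ Wup ∨ y ∈ Wup by
      rcases hxy with hW' | hW'
      · exact .inl (hG.out (hWG x hW') hy ⟨hxz, hzy⟩)
      · exact .inr (hH.out hx (hWH y hW') ⟨hxz, hzy⟩)
    suffices hmid : ∃ z', x ≤ z' ∧ z' ≤ y ∧ diagB p ≤ diagB z' ∧ diagB z' ≤ diagB q by
      obtain ⟨z', hxz', hzy', h₁, h₂⟩ := hmid
      obtain ⟨w, hw, hwz⟩ := hW _ h₁ h₂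
      rcases total w z' hwz with hle | hle
      · exact .inr (hGW y hy w hw (hle.trans hzy'))
      · exact .inl (hHW x hx w hw (hxz'.trans hle))
    have hxy := hxz.trans hzy
    have hpx := hHp x hx
    have hyq := hGq y hy
    rcases le_or_gt (diagB p) (diagB y) with hpy | hpy
    · exact ⟨y, hxy, le_rfl, hpy, hyq⟩
    · refine ⟨(x.2 - diagB p, x.2), ?_, ?_, ?_, ?_⟩
      · simp only [diagB, Prod.le_def] at *
        omega
      · simp only [diagB, Prod.le_def] at *
        omega
      · simp [diagB]
      · simpa [diagB] using hHp q (hWH q hq)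
  · exact .inr (hH.out hx hy ⟨hxz, hzy⟩)

theorem disjoint (h : OverlapData γ Wlow Wup v δ a b) : Disjoint Wlow Wup := by
  obtain ⟨k, h₁, h₂⟩ := h.separated
  exact Set.disjoint_left.2 fun x hx hx' => lt_asymm (h₁ x hx) (h₂ x hx')

theorem diagB_pos (h : OverlapData γ Wlow Wup v δ a b) : 0 < diagB v := by
  obtain ⟨k, h₁, h₂⟩ := h.separated
  have h₃ := h₁ _ ((h.mem_up _).1 h.add_mem_up)
  have h₄ := h₂ _ h.add_mem_up
  simp only [diagB, Prod.fst_sub, Prod.snd_sub] at *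
  omega

/-- The box north of the northeasternmost box of `O`, and its translate, lie outside the
amalgamation. -/
theorem north_notMem (h : OverlapData γ Wlow Wup v (0, 1) a b) :
    b - (1, 0) ∉ amalgam γ v ∧ b + v - (1, 0) ∉ amalgam γ v := by
  obtain ⟨k, hk, hk'⟩ := h.separated
  have hb := h.mem_b
  have hbk := hk' _ h.add_mem_up
  have hup : b - (1, 0) ∉ Wup := fun hu => hb.2 <| .inr <|
    h.ordConnected_up.out hu h.add_mem_up
      ⟨sub_le_self _ ⟨zero_le_one, le_rfl⟩, le_add_of_nonneg_right ⟨le_rfl, zero_le_one⟩⟩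
  have hγ : b - (1, 0) ∉ γ := fun hmem => by
    have hlow : b - (1, 0) ∉ Wlow := fun hl => by
      have := hk _ hl
      simp only [diagB, Prod.fst_sub, Prod.snd_sub, Prod.fst_add, Prod.snd_add] at *
      omega
    have := (h.ne_b _ ⟨hmem, by simp [hup, hlow]⟩).1
    simp at this
  have hle : b - (1, 0) ≤ b + (0, 1) :=
    le_trans (b := b) (sub_le_self _ ⟨zero_le_one, le_rfl⟩)
      (le_add_of_nonneg_right ⟨le_rfl, zero_le_one⟩)
  have hγv : b - (1, 0) - v ∉ γ := fun hmem =>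
    h.not_le_low hmem (fun hl => hup ((h.mem_up _).2 hl)) ((h.mem_up _).1 h.add_mem_up)
      (sub_le_sub_right hle v)
  refine ⟨fun hA => hA.elim hγ hγv, fun hA => hA.elim (fun hmem => ?_) (fun hmem => hγ ?_)⟩
  · obtain ⟨p, -, q, hq, hqγ, -⟩ := h.exists_extreme_diagB
    have h₁ := hqγ _ hmem
    have h₂ := hk _ ((h.mem_up _).1 hq)
    simp only [diagB, Prod.fst_sub, Prod.snd_sub, Prod.fst_add, Prod.snd_add] at *
    omega
  · convert hmem using 1
    abel

/-- The box south of the southwesternmost box of `O`, and its translate, lie outside the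
amalgamation. -/
theorem south_notMem (h : OverlapData γ Wlow Wup v (0, 1) a b) :
    a + (1, 0) ∉ amalgam γ v ∧ a + v + (1, 0) ∉ amalgam γ v := by
  obtain ⟨h₁, h₂⟩ := h.neg.north_notMem
  constructor
  · refine fun hA => h₂ (hA.symm.imp (fun h' => ?_) (fun h' => ?_)) <;>
    · change _ ∈ γ
      convert h' using 1
      abel
  · refine fun hA => h₁ (hA.symm.imp (fun h' => ?_) (fun h' => ?_)) <;>
    · change _ ∈ γ
      convert h' using 1
      abel

end OverlapData
/-- A set of boxes with exactly one box on each diagonal from that of `p` to that of `q`, whose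
consecutive boxes differ by a step east or a step north, has as many boxes, rows and columns as
a lattice path from `p` to `q`. -/
theorem card_rowsOf_colsOf_of_path {F : Finset Box} {p q : Box} (hp : p ∈ F) (hq : q ∈ F)
    (hrange : ∀ x ∈ F, diagB p ≤ diagB x ∧ diagB x ≤ diagB q)
    (hex : ∀ d, diagB p ≤ d → d ≤ diagB q → ∃ x ∈ F, diagB x = d)
    (huniq : ∀ x ∈ F, ∀ y ∈ F, diagB x = diagB y → x = y)
    (hstep : ∀ x ∈ F, ∀ y ∈ F, diagB y = diagB x + 1 → y.1 = x.1 ∨ y.1 = x.1 - 1) :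
    F.card = (diagB q + 1 - diagB p).toNat ∧ rowsOf F = (p.1 + 1 - q.1).toNat ∧
      colsOf F = (q.2 + 1 - p.2).toNat := by
  have hrow : ∀ (n : ℕ), ∀ x ∈ F, ∀ y ∈ F, diagB y = diagB x + n →
      (y.1 ≤ x.1 ∧ x.2 ≤ y.2) ∧ (∀ r, y.1 ≤ r → r ≤ x.1 → ∃ z ∈ F, z.1 = r) ∧
      ∀ c, x.2 ≤ c → c ≤ y.2 → ∃ z ∈ F, z.2 = c := by
    intro n
    induction n with
    | zero =>
      intro x hx y hy hxy
      obtain rfl := huniq y hy x hx (by simpa using hxy)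
      exact ⟨⟨le_rfl, le_rfl⟩, fun r h₁ h₂ => ⟨y, hx, le_antisymm h₁ h₂⟩,
        fun c h₁ h₂ => ⟨y, hx, le_antisymm h₁ h₂⟩⟩
    | succ n ih =>
      intro x hx y hy hxy
      push_cast at hxy
      obtain ⟨z, hz, hzd⟩ := hex (diagB x + n) (by have := hrange x hx; omega)
        (by have := hrange y hy; omega)
      obtain ⟨⟨h₁, h₂⟩, h₃, h₄⟩ := ih x hx z hz hzd
      have hs := hstep z hz y hy (by omega)
      have hxy' := hxy
      have hzd' := hzd
      simp only [diagB] at hxy' hzd'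
      refine ⟨⟨by omega, by omega⟩, fun r hr hr' => ?_, fun c hc hc' => ?_⟩
      · rcases eq_or_ne r y.1 with rfl | hne
        · exact ⟨y, hy, rfl⟩
        · exact h₃ r (by omega) hr'
      · rcases eq_or_ne c y.2 with rfl | hne
        · exact ⟨y, hy, rfl⟩
        · exact h₄ c hc (by omega)
  have hmono : ∀ x ∈ F, ∀ y ∈ F, diagB x ≤ diagB y → y.1 ≤ x.1 ∧ x.2 ≤ y.2 :=
    fun x hx y hy hxy => (hrow (diagB y - diagB x).toNat x hx y hy (by omega)).1
  have hall := hrow (diagB q - diagB p).toNat p hp q hq (by have := hrange p hp; omega)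
  refine ⟨?_, ?_, ?_⟩
  · rw [← Int.card_Icc, ← Finset.card_image_of_injOn (f := diagB)
      (fun x hx y hy hxy => huniq x hx y hy hxy)]
    congr 1
    ext d
    simp only [Finset.mem_image, Finset.mem_Icc]
    exact ⟨fun ⟨x, hx, hd⟩ => hd ▸ hrange x hx, fun hd => hex d hd.1 hd.2⟩
  · rw [rowsOf, ← Int.card_Icc]
    congr 1
    ext r
    simp only [Finset.mem_image, Finset.mem_Icc]
    refine ⟨?_, fun hr => hall.2.1 r hr.1 hr.2⟩
    rintro ⟨x, hx, rfl⟩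
    exact ⟨(hmono x hx q hq (hrange x hx).2).1, (hmono p hp x hx (hrange x hx).1).1⟩
  · rw [colsOf, ← Int.card_Icc]
    congr 1
    ext c
    simp only [Finset.mem_image, Finset.mem_Icc]
    refine ⟨?_, fun hc => hall.2.2 c hc.1 hc.2⟩
    rintro ⟨x, hx, rfl⟩
    exact ⟨(hmono p hp x hx (hrange x hx).1).2, (hmono x hx q hq (hrange x hx).2).2⟩

/-- The part of the upper-left boundary of an order-convex set between two of its boxes is a
lattice path. -/
theorem card_rowsOf_colsOf_upper_left {A : Set Box} (hA : A.OrdConnected) {F : Finset Box}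
    {p q : Box} (hp : p ∈ F) (hq : q ∈ F)
    (hF : ∀ x, x ∈ F ↔ (x ∈ A ∧ x - (1, 1) ∉ A) ∧ diagB p ≤ diagB x ∧ diagB x ≤ diagB q)
    (hdiag : ∀ d, diagB p ≤ d → d ≤ diagB q → ∃ x ∈ A, diagB x = d) (hfin : A.Finite) :
    F.card = (diagB q + 1 - diagB p).toNat ∧ rowsOf F = (p.1 + 1 - q.1).toNat ∧
      colsOf F = (q.2 + 1 - p.2).toNat := by
  have hcov : ∀ x ∈ F, ∀ y ∈ F, ¬ (x.1 + 1 ≤ y.1 ∧ x.2 + 1 ≤ y.2) := fun x hx y hy hxy =>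
    ((hF y).1 hy).1.2 <| hA.box_mem ((hF x).1 hx).1.1 ((hF y).1 hy).1.1
      (show x.1 ≤ y.1 - 1 by omega) (by omega) (show x.2 ≤ y.2 - 1 by omega) (by omega)
  refine card_rowsOf_colsOf_of_path hp hq (fun x hx => ((hF x).1 hx).2) (fun d h₁ h₂ => ?_)
    (fun x hx y hy hxy => ?_) (fun x hx y hy hxy => ?_)
  · obtain ⟨x, ⟨hx, hxd⟩, hmin⟩ := Set.exists_min_image {x ∈ A | diagB x = d} Prod.fst
      (hfin.subset fun x hx => hx.1) (hdiag d h₁ h₂)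
    refine ⟨x, (hF x).2 ⟨⟨hx, fun hx' => ?_⟩, by omega, by omega⟩, hxd⟩
    have := hmin (x - (1, 1)) ⟨hx', by simp only [diagB, Prod.fst_sub, Prod.snd_sub] at *; omega⟩
    simp at this
  · have h₁ := hcov x hx y hy
    have h₂ := hcov y hy x hx
    simp only [diagB] at hxy
    exact Prod.ext (by omega) (by omega)
  · have h₁ := hcov x hx y hy
    have h₂ := hcov y hy x hx
    simp only [diagB] at hxy
    omega

/-- The part of the bottom-right boundary of an order-convex set between two of its boxes is a
lattice path. -/
theorem card_rowsOf_colsOf_bottom_right {A : Set Box} (hA : A.OrdConnected) {F : Finset Box}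
    {p q : Box} (hp : p ∈ F) (hq : q ∈ F)
    (hF : ∀ x, x ∈ F ↔ (x ∈ A ∧ x + (1, 1) ∉ A) ∧ diagB p ≤ diagB x ∧ diagB x ≤ diagB q)
    (hdiag : ∀ d, diagB p ≤ d → d ≤ diagB q → ∃ x ∈ A, diagB x = d) (hfin : A.Finite) :
    F.card = (diagB q + 1 - diagB p).toNat ∧ rowsOf F = (p.1 + 1 - q.1).toNat ∧
      colsOf F = (q.2 + 1 - p.2).toNat := by
  have hcov : ∀ x ∈ F, ∀ y ∈ F, ¬ (x.1 + 1 ≤ y.1 ∧ x.2 + 1 ≤ y.2) := fun x hx y hy hxy =>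
    ((hF x).1 hx).1.2 <| hA.box_mem ((hF x).1 hx).1.1 ((hF y).1 hy).1.1
      (show x.1 ≤ x.1 + 1 by omega) (by omega) (show x.2 ≤ x.2 + 1 by omega) (by omega)
  refine card_rowsOf_colsOf_of_path hp hq (fun x hx => ((hF x).1 hx).2) (fun d h₁ h₂ => ?_)
    (fun x hx y hy hxy => ?_) (fun x hx y hy hxy => ?_)
  · obtain ⟨x, ⟨hx, hxd⟩, hmax⟩ := Set.exists_max_image {x ∈ A | diagB x = d} Prod.fst
      (hfin.subset fun x hx => hx.1) (hdiag d h₁ h₂)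
    refine ⟨x, (hF x).2 ⟨⟨hx, fun hx' => ?_⟩, by omega, by omega⟩, hxd⟩
    have := hmax (x + (1, 1)) ⟨hx', by simp only [diagB, Prod.fst_add, Prod.snd_add] at *; omega⟩
    simp at this
  · have h₁ := hcov x hx y hy
    have h₂ := hcov y hy x hx
    simp only [diagB] at hxy
    exact Prod.ext (by omega) (by omega)
  · have h₁ := hcov x hx y hy
    have h₂ := hcov y hy x hx
    simp only [diagB] at hxy
    omega

namespace OverlapData

variable {γ Wlow Wup : Set Box} {v δ a b : Box}

theorem a_mem_amalgam (h : OverlapData γ Wlow Wup v δ a b) :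
    a ∈ amalgam γ v ∧ a + v ∈ amalgam γ v :=
  ⟨.inl h.mem_a.1, .inr (by simpa using h.mem_a.1)⟩

theorem b_mem_amalgam (h : OverlapData γ Wlow Wup v δ a b) :
    b ∈ amalgam γ v ∧ b + v ∈ amalgam γ v :=
  ⟨.inl h.mem_b.1, .inr (by simpa using h.mem_b.1)⟩

/-- The northeasternmost box of `O` and its translate lie on the upper-left boundary of the
amalgamation. -/
theorem sub_one_notMem (h : OverlapData γ Wlow Wup v (0, 1) a b) :
    b - (1, 1) ∉ amalgam γ v ∧ b + v - (1, 1) ∉ amalgam γ v := by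
  have hA := h.ordConnected_amalgam
  refine ⟨fun hb => h.north_notMem.1 ?_, fun hb => h.north_notMem.2 ?_⟩
  · exact hA.out hb h.b_mem_amalgam.1 (by simp [Prod.le_def])
  · exact hA.out hb h.b_mem_amalgam.2 (by simp [Prod.le_def])

/-- The southwesternmost box of `O` and its translate lie on the bottom-right boundary of the
amalgamation. -/
theorem add_one_notMem (h : OverlapData γ Wlow Wup v (0, 1) a b) :
    a + (1, 1) ∉ amalgam γ v ∧ a + v + (1, 1) ∉ amalgam γ v := by
  have hA := h.ordConnected_amalgam
  refine ⟨fun hb => h.south_notMem.1 ?_, fun hb => h.south_notMem.2 ?_⟩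
  · exact hA.out h.a_mem_amalgam.1 hb (by simp [Prod.le_def])
  · exact hA.out h.a_mem_amalgam.2 hb (by simp [Prod.le_def])

theorem finite_amalgam (hγ : γ.Finite) : (amalgam γ v).Finite :=
  hγ.union (hγ.preimage (sub_left_injective.injOn))

/-- The number of boxes, rows and columns of the top key ribbon of a `W → O → W` shape. -/
theorem card_top (h : OverlapData γ Wlow Wup v (0, 1) a b) (hγ : γ.Finite) {F : Finset Box}
    (hF : ∀ x, x ∈ F ↔ (x ∈ amalgam γ v ∧ x - (1, 1) ∉ amalgam γ v) ∧
      diagB b < diagB x ∧ diagB x ≤ diagB (b + v)) :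
    F.card = (diagB v).toNat ∧ rowsOf F = (1 - v.1).toNat ∧ colsOf F = v.2.toNat := by
  have hv := h.diagB_pos
  have hd : diagB (b + (0, 1)) = diagB b + 1 := by simp [diagB]; ring
  have hd' : diagB (b + v) = diagB b + diagB v := by simp [diagB]; ring
  have hp : b + (0, 1) ∈ F := by
    refine (hF _).2 ⟨⟨.inl (h.up_subset h.add_mem_up), fun hn => h.north_notMem.1 ?_⟩, by omega,
      by omega⟩
    convert hn using 1
    ext <;> simp
  have hq : b + v ∈ F :=
    (hF _).2 ⟨⟨h.b_mem_amalgam.2, h.sub_one_notMem.2⟩, by omega, by omega⟩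
  have := card_rowsOf_colsOf_upper_left h.ordConnected_amalgam hp hq
    (fun x => by rw [hF, hd, Int.add_one_le_iff]) (fun d h₁ h₂ => ?_) (finite_amalgam hγ)
  · obtain ⟨e₁, e₂, e₃⟩ := this
    rw [e₁, e₂, e₃, hd, hd']
    simp only [Prod.fst_add, Prod.snd_add]
    refine ⟨?_, ?_, ?_⟩ <;> congr 1 <;> ring
  · have hlow := (h.mem_up _).1 h.add_mem_up
    obtain ⟨x, hx, hxd⟩ := exists_mem_diagB_eq h.diagConnected_diff_up
      (p := b + (0, 1) - v) (q := b)
      ⟨h.low_subset hlow, Set.disjoint_left.1 h.disjoint hlow⟩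
      ⟨h.mem_b.1, fun hb => h.mem_b.2 (.inr hb)⟩ (d := d - diagB v)
      (by simp only [diagB, Prod.fst_sub, Prod.snd_sub] at *; omega) (by omega)
    exact ⟨x + v, .inr (by simpa using hx.1),
      by simp only [diagB, Prod.fst_add, Prod.snd_add] at *; omega⟩

/-- The number of boxes, rows and columns of the bottom key ribbon of a `W → O → W` shape. -/
theorem card_bottom (h : OverlapData γ Wlow Wup v (0, 1) a b) (hγ : γ.Finite) {F : Finset Box}
    (hF : ∀ x, x ∈ F ↔ (x ∈ amalgam γ v ∧ x + (1, 1) ∉ amalgam γ v) ∧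
      diagB a ≤ diagB x ∧ diagB x < diagB (a + v)) :
    F.card = (diagB v).toNat ∧ rowsOf F = (1 - v.1).toNat ∧ colsOf F = v.2.toNat := by
  have hv := h.diagB_pos
  have hd : diagB (a + v - (0, 1)) = diagB (a + v) - 1 := by simp [diagB]; ring
  have hd' : diagB (a + v) = diagB a + diagB v := by simp [diagB]; ring
  have hup : a + v - (0, 1) ∈ Wup := by
    rw [h.mem_up]
    convert h.sub_mem_low using 1
    abel
  have hp : a ∈ F :=
    (hF _).2 ⟨⟨h.a_mem_amalgam.1, h.add_one_notMem.1⟩, by omega, by omega⟩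
  have hq : a + v - (0, 1) ∈ F := by
    refine (hF _).2 ⟨⟨.inl (h.up_subset hup), fun hn => h.south_notMem.2 ?_⟩, by omega, by omega⟩
    convert hn using 1
    ext <;> simp
  have := card_rowsOf_colsOf_bottom_right h.ordConnected_amalgam hp hq
    (fun x => by rw [hF, hd, Int.le_sub_one_iff]) (fun d h₁ h₂ => ?_) (finite_amalgam hγ)
  · obtain ⟨e₁, e₂, e₃⟩ := this
    rw [e₁, e₂, e₃, hd, hd']
    simp only [Prod.fst_add, Prod.snd_add, Prod.fst_sub, Prod.snd_sub]
    refine ⟨?_, ?_, ?_⟩ <;> congr 1 <;> ring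
  · obtain ⟨x, hx, hxd⟩ := exists_mem_diagB_eq h.diagConnected_diff_low
      (q := a + v - (0, 1)) ⟨h.mem_a.1, fun hb => h.mem_a.2 (.inl hb)⟩
      ⟨h.up_subset hup, Set.disjoint_right.1 h.disjoint hup⟩ h₁ h₂
    exact ⟨x, .inl hx.1, hxd⟩

end OverlapData

theorem mem_translateS {t x : Box} {S : Finset Box} : x ∈ translateS t S ↔ x - t ∈ S := by
  simp only [translateS, Finset.mem_image]
  constructor
  · rintro ⟨y, hy, rfl⟩
    simpa using hy
  · exact fun hx => ⟨_, hx, by abel⟩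

theorem translateS_ordConnected {t : Box} {S : Finset Box} (h : (S : Set Box).OrdConnected) :
    (translateS t S : Set Box).OrdConnected := by
  refine ⟨fun x hx y hy z hz => ?_⟩
  simp only [Finset.mem_coe, mem_translateS] at *
  exact h.out hx hy ⟨sub_le_sub_right hz.1 t, sub_le_sub_right hz.2 t⟩

theorem IsNEBox.le {S : Finset Box} {b : Box} (hS : (S : Set Box).OrdConnected)
    (hb : IsNEBox S b) : ∀ x ∈ S, b.1 ≤ x.1 ∧ x.2 ≤ b.2 := by
  refine fun x hx => ⟨hb.2.1 x hx, ?_⟩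
  by_contra hlt
  have hm : ((b.1, x.2) : Box) ∈ S := hS.box_mem hb.1 hx le_rfl (hb.2.1 x hx) (by omega) le_rfl
  exact hlt (hb.2.2 (b.1, x.2) hm rfl)

theorem IsSWBox.le {S : Finset Box} {b : Box} (hS : (S : Set Box).OrdConnected)
    (hb : IsSWBox S b) : ∀ x ∈ S, x.1 ≤ b.1 ∧ b.2 ≤ x.2 := by
  refine fun x hx => ⟨hb.2.1 x hx, ?_⟩
  by_contra hlt
  have hm : ((b.1, x.2) : Box) ∈ S := hS.box_mem hx hb.1 (hb.2.1 x hx) le_rfl le_rfl (by omega)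
  exact hlt (hb.2.2 (b.1, x.2) hm rfl)

theorem IsWOW.exists_overlapData {right : Bool} {γ W O Wlow Wup : Finset Box} {v : Box}
    (h : IsWOW right γ W O Wlow Wup v) :
    O = γ \ (Wlow ∪ Wup) ∧ ∃ a b, OverlapData (γ : Set Box) Wlow Wup v
      (if right then (0, 1) else (-1, 0)) a b := by
  obtain ⟨hγ, hW, ⟨⟨t, htl⟩, hlγ, hlc, s, hs, hsl⟩, ⟨⟨t', htu⟩, huγ, huc, e, he, heu⟩, hv, hγu,
    hcu, hγl, hcl, hO, ⟨k, hk⟩, hatt, -⟩ := h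
  have hγ' := hγ.ordConnected
  have hγu' := hγu.ordConnected
  have hγl' := hγl.ordConnected
  have hO' : (O : Set Box).OrdConnected := by
    have := hγl'.inter hγu'
    rw [hO]
    convert this using 1
    push_cast
    ext x
    simp only [Set.mem_sdiff, Set.mem_union, Set.mem_inter_iff]
    tauto
  obtain ⟨a, b, ha, hb, hab⟩ : ∃ a b, IsSWBox O a ∧ IsNEBox O b ∧
      a - (if right then (0, 1) else (-1, 0)) ∈ Wlow ∧
      b + (if right then (0, 1) else (-1, 0)) ∈ Wup := by
    cases right
    · simp only [Bool.false_eq_true, if_false] at hatt ⊢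
      obtain ⟨⟨a, ha, ha'⟩, b, hb, hb'⟩ := hatt
      refine ⟨a, b, ha, hb, ?_, ?_⟩
      · convert ha' using 1
        ext <;> simp
      · convert hb' using 1
        ext <;> simp [sub_eq_add_neg]
    · simp only [if_true] at hatt ⊢
      obtain ⟨⟨a, ha, ha'⟩, b, hb, hb'⟩ := hatt
      refine ⟨a, b, ha, hb, ?_, ?_⟩
      · convert ha' using 1
        ext <;> simp
      · convert hb' using 1
        ext <;> simp
  have hmemO : ∀ x : Box, x ∈ O ↔ x ∈ (γ \ (Wlow ∪ Wup) : Set Box) := fun x => by simp [hO]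
  refine ⟨hO, a, b, ?_⟩
  exact
    { ordConnected := hγ'
      ordConnected_low := htl ▸ translateS_ordConnected hW.ordConnected
      ordConnected_up := htu ▸ translateS_ordConnected hW.ordConnected
      ordConnected_diff_low := by exact_mod_cast hγl'
      ordConnected_diff_up := by exact_mod_cast hγu'
      diagConnected_low := hlc.diagConnected
      diagConnected_up := huc.diagConnected
      diagConnected_diff_low := by exact_mod_cast hcl.diagConnected
      diagConnected_diff_up := by exact_mod_cast hcu.diagConnected
      low_subset := hlγ
      up_subset := huγ
      mem_up := fun x => by rw [← hv]; exact mem_translateS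
      separated := ⟨k, hk⟩
      exists_sw := ⟨s, hsl, hs.le hγ'⟩
      exists_ne := ⟨e, heu, he.le hγ'⟩
      mem_a := (hmemO a).1 ha.1
      mem_b := (hmemO b).1 hb.1
      sw_a := fun x hx => ha.le hO' x ((hmemO x).2 hx)
      ne_b := fun x hx => hb.le hO' x ((hmemO x).2 hx)
      sub_mem_low := hab.1
      add_mem_up := hab.2 }

theorem mem_ulBoundary_amalgam {γ : Finset Box} {v x : Box} :
    x ∈ ulBoundary (γ ∪ translateS v γ) ↔
      x ∈ amalgam (γ : Set Box) v ∧ x - (1, 1) ∉ amalgam (γ : Set Box) v := by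
  simp only [ulBoundary, Finset.mem_filter, Finset.mem_union, mem_translateS, amalgam]
  rfl

theorem mem_brBoundary_amalgam {γ : Finset Box} {v x : Box} :
    x ∈ brBoundary (γ ∪ translateS v γ) ↔
      x ∈ amalgam (γ : Set Box) v ∧ x + (1, 1) ∉ amalgam (γ : Set Box) v := by
  simp only [brBoundary, Finset.mem_filter, Finset.mem_union, mem_translateS, amalgam]
  rfl

section KeyRibbonIntervals

variable {B O : Finset Box} {v : Box}

theorem between_iff_of_ne {b : Box} (hb : b ∈ O) (hO : ∀ x ∈ O, b.1 ≤ x.1 ∧ x.2 ≤ b.2)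
    (hbB : b ∈ B) (hbB' : b + v ∈ B) (x : Box) :
    ((∀ b' ∈ B ∩ O, diagB b' < diagB x) ∧ ∃ b' ∈ B ∩ translateS v O, diagB x ≤ diagB b') ↔
      diagB b < diagB x ∧ diagB x ≤ diagB (b + v) := by
  simp only [Finset.mem_inter, mem_translateS]
  refine and_congr ⟨fun h => h b ⟨hbB, hb⟩, fun h y hy => ?_⟩
    ⟨?_, fun h => ⟨b + v, ⟨hbB', by simpa⟩, h⟩⟩
  · have := hO y hy.2
    simp only [diagB] at *
    omega
  · rintro ⟨y, hy, hxy⟩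
    have := hO _ hy.2
    simp only [diagB, Prod.fst_add, Prod.snd_add, Prod.fst_sub, Prod.snd_sub] at *
    omega

theorem between_iff_of_sw {a : Box} (ha : a ∈ O) (hO : ∀ x ∈ O, x.1 ≤ a.1 ∧ a.2 ≤ x.2)
    (haB : a ∈ B) (haB' : a + v ∈ B) (x : Box) :
    ((∃ b' ∈ B ∩ O, diagB b' ≤ diagB x) ∧ ∀ b' ∈ B ∩ translateS v O, diagB x < diagB b') ↔
      diagB a ≤ diagB x ∧ diagB x < diagB (a + v) := by
  simp only [Finset.mem_inter, mem_translateS]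
  refine and_congr ⟨?_, fun h => ⟨a, ⟨haB, ha⟩, h⟩⟩
    ⟨fun h => h (a + v) ⟨haB', by simpa⟩, fun h y hy => ?_⟩
  · rintro ⟨y, hy, hxy⟩
    have := hO _ hy.2
    simp only [diagB] at *
    omega
  · have := hO _ hy.2
    simp only [diagB, Prod.fst_add, Prod.snd_add, Prod.fst_sub, Prod.snd_sub] at *
    omega

end KeyRibbonIntervals

theorem rowsOf_image_flipBox (F : Finset Box) : rowsOf (F.image flipBox) = colsOf F := by
  rw [rowsOf, colsOf, Finset.image_image,
    ← Finset.card_image_of_injective (F.image Prod.snd) neg_injective, Finset.image_image]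
  rfl

theorem colsOf_image_flipBox (F : Finset Box) : colsOf (F.image flipBox) = rowsOf F := by
  rw [rowsOf, colsOf, Finset.image_image,
    ← Finset.card_image_of_injective (F.image Prod.fst) neg_injective, Finset.image_image]
  rfl

theorem mem_image_flipBox {F : Finset Box} {x : Box} : x ∈ F.image flipBox ↔ flipBox x ∈ F := by
  rw [← flipBox_injective.mem_finset_image (s := F), flipBox_flipBox]

theorem mem_amalgam_flip {γ : Set Box} {v x : Box} :
    x ∈ amalgam {y | flipBox y ∈ γ} (flipBox v) ↔ flipBox x ∈ amalgam γ v := by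
  simp [amalgam, flipBox_sub]

/-- Lemma "size lemma".
For a `W→O→W` or `W↑O↑W` shape `γ`, the top key ribbon and the bottom key ribbon have
the same size, the same number of rows, and the same number of columns. -/
theorem statement6 (right : Bool) (γ W O Wlow Wup : Finset Box) (v : Box)
    (hWOW : IsWOW right γ W O Wlow Wup v) :
    (topKeyRibbon right γ O v).card = (bottomKeyRibbon right γ O v).card ∧
    rowsOf (topKeyRibbon right γ O v) = rowsOf (bottomKeyRibbon right γ O v) ∧
    colsOf (topKeyRibbon right γ O v) = colsOf (bottomKeyRibbon right γ O v) := by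
  obtain ⟨hO, a, b, h⟩ := hWOW.exists_overlapData
  have hmemO : ∀ x : Box, x ∈ O ↔ x ∈ (γ \ (Wlow ∪ Wup) : Set Box) := fun x => by simp [hO]
  have ha := (hmemO a).2 h.mem_a
  have hb := (hmemO b).2 h.mem_b
  have hne : ∀ x ∈ O, b.1 ≤ x.1 ∧ x.2 ≤ b.2 := fun x hx => h.ne_b x ((hmemO x).1 hx)
  have hsw : ∀ x ∈ O, x.1 ≤ a.1 ∧ a.2 ≤ x.2 := fun x hx => h.sw_a x ((hmemO x).1 hx)
  cases right
  · have hf : OverlapData _ _ _ (flipBox v) (0, 1) _ _ := h.flip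
    have hfin : {x | flipBox x ∈ (γ : Set Box)}.Finite :=
      γ.finite_toSet.preimage flipBox_injective.injOn
    have hsub : ∀ x : Box, flipBox (x - (1, 1)) = flipBox x + (1, 1) := fun x => by
      rw [flipBox_sub, sub_eq_add_neg]; rfl
    have hadd : ∀ x : Box, flipBox (x + (1, 1)) = flipBox x - (1, 1) := fun x => by
      rw [flipBox_add, sub_eq_add_neg]; rfl
    have htop := hf.card_bottom hfin (F := (topKeyRibbon false γ O v).image flipBox) (fun x => by
      simp only [topKeyRibbon, mem_image_flipBox, Bool.false_eq_true, if_false,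
        Finset.mem_filter]
      rw [between_iff_of_sw ha hsw, mem_ulBoundary_amalgam, mem_amalgam_flip, mem_amalgam_flip,
        hadd, diagB_flipBox, diagB_flipBox, ← flipBox_add, diagB_flipBox]
      · have h₁ := hf.add_one_notMem.1
        rw [mem_amalgam_flip, hadd, flipBox_flipBox] at h₁
        exact mem_ulBoundary_amalgam.2 ⟨h.a_mem_amalgam.1, h₁⟩
      · have h₁ := hf.add_one_notMem.2
        rw [mem_amalgam_flip, hadd, ← flipBox_add, flipBox_flipBox] at h₁
        exact mem_ulBoundary_amalgam.2 ⟨h.a_mem_amalgam.2, h₁⟩)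
    have hbot := hf.card_top hfin (F := (bottomKeyRibbon false γ O v).image flipBox) (fun x => by
      simp only [bottomKeyRibbon, mem_image_flipBox, Bool.false_eq_true, if_false,
        Finset.mem_filter]
      rw [between_iff_of_ne hb hne, mem_brBoundary_amalgam, mem_amalgam_flip, mem_amalgam_flip,
        hsub, diagB_flipBox, diagB_flipBox, ← flipBox_add, diagB_flipBox]
      · have h₁ := hf.sub_one_notMem.1
        rw [mem_amalgam_flip, hsub, flipBox_flipBox] at h₁
        exact mem_brBoundary_amalgam.2 ⟨h.b_mem_amalgam.1, h₁⟩
      · have h₁ := hf.sub_one_notMem.2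
        rw [mem_amalgam_flip, hsub, ← flipBox_add, flipBox_flipBox] at h₁
        exact mem_brBoundary_amalgam.2 ⟨h.b_mem_amalgam.2, h₁⟩)
    rw [Finset.card_image_of_injective _ flipBox_injective, rowsOf_image_flipBox,
      colsOf_image_flipBox] at htop hbot
    exact ⟨htop.1.trans hbot.1.symm, htop.2.2.trans hbot.2.2.symm,
      htop.2.1.trans hbot.2.1.symm⟩
  · have hr : OverlapData _ _ _ v (0, 1) a b := h
    have htop := hr.card_top γ.finite_toSet (F := topKeyRibbon true γ O v) (fun x => by
      simp only [topKeyRibbon, if_true, Finset.mem_filter]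
      rw [between_iff_of_ne hb hne
        (mem_ulBoundary_amalgam.2 ⟨hr.b_mem_amalgam.1, hr.sub_one_notMem.1⟩)
        (mem_ulBoundary_amalgam.2 ⟨hr.b_mem_amalgam.2, hr.sub_one_notMem.2⟩),
        mem_ulBoundary_amalgam])
    have hbot := hr.card_bottom γ.finite_toSet (F := bottomKeyRibbon true γ O v) (fun x => by
      simp only [bottomKeyRibbon, if_true, Finset.mem_filter]
      rw [between_iff_of_sw ha hsw
        (mem_brBoundary_amalgam.2 ⟨hr.a_mem_amalgam.1, hr.add_one_notMem.1⟩)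
        (mem_brBoundary_amalgam.2 ⟨hr.a_mem_amalgam.2, hr.add_one_notMem.2⟩),
        mem_brBoundary_amalgam])
    exact ⟨htop.1.trans hbot.1.symm, htop.2.1.trans hbot.2.1.symm,
      htop.2.2.trans hbot.2.2.symm⟩
end
end
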